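/- Every triangle-free matchstick graph on n vertices satisfies: the number of its edges is at least ⌊2n - √(2n - 7/4) - 3/2⌋ when it has the maximum number of edges among all triangle-free matchstick graphs on n vertices; combined with the upper bound, the maximum number e(n) of edges of a triangle-free matchstick graph on n vertices satisfies 2n - √2·√n - O(1) ≤ e(n) ≤ 2n - (√2/5)·√n, i.e., there is an absolute constant C such that for all n ≥ 1, 2n - √2·√n - C ≤ e(n) ≤ 2n - (√2/5)·√n. (Theorem 1 in full.) -/

import Mathlib

/-- A *matchstick embedding* (drawing) of a simple graph `G`: the vertices are
represented by distinct points of the Euclidean plane, every edge is a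
straight-line segment of unit length, two segments representing distinct edges
intersect in at most a common endpoint, and no vertex point lies in the
relative interior (open segment) of any edge segment. A graph admitting such an
embedding is a *matchstick graph*. -/
structure MatchstickEmbedding {V : Type*} (G : SimpleGraph V) where
  /-- the position of each vertex in the plane -/
  pos : V → EuclideanSpace ℝ (Fin 2)
  /-- the vertex points are distinct -/
  inj : Function.Injective pos
  /-- every edge has unit length -/
  unit : ∀ u v : V, G.Adj u v → dist (pos u) (pos v) = 1
  /-- no vertex lies in the relative interior of an edge segment -/
  noVertexInterior : ∀ w u v : V, G.Adj u v → pos w ∉ openSegment ℝ (pos u) (pos v)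
  /-- segments of distinct edges intersect in at most a common endpoint -/
  noncross : ∀ u v a b : V, G.Adj u v → G.Adj a b → s(u, v) ≠ s(a, b) →
    segment ℝ (pos u) (pos v) ∩ segment ℝ (pos a) (pos b) ⊆
      ({pos u, pos v} ∩ {pos a, pos b} : Set (EuclideanSpace ℝ (Fin 2)))

/-- `e(n)`: the maximum number of edges of a triangle-free matchstick graph on
`n` vertices. (The set of achievable edge counts is nonempty — e.g. the empty
graph — and bounded, since planar graphs have at most `3n` edges, so this
supremum in `ℕ` is indeed the maximum.) -/
noncomputable def maxTriangleFreeMatchstickEdges (n : ℕ) : ℕ :=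
  sSup {e : ℕ | ∃ G : SimpleGraph (Fin n),
    G.CliqueFree 3 ∧ Nonempty (MatchstickEmbedding G) ∧ e = G.edgeSet.ncard}



/-- Combinatorial description of a plane straight line drawing. -/
structure PG (V E : Type) where
  x : V → ℝ
  y : V → ℝ
  L : E → V
  R : E → V
  xinj : Function.Injective x
  lt : ∀ e, x (L e) < x (R e)
  ext : ∀ e e', L e = L e' → R e = R e' → e = e'
  noc : ∀ e e', e ≠ e' → ∀ t, x (L e) ≤ t → t ≤ x (R e) → x (L e') ≤ t → t ≤ x (R e') →
    y (L e) + (t - x (L e)) * ((y (R e) - y (L e)) / (x (R e) - x (L e))) =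
    y (L e') + (t - x (L e')) * ((y (R e') - y (L e')) / (x (R e') - x (L e'))) →
    ∃ v, (v = L e ∨ v = R e) ∧ (v = L e' ∨ v = R e') ∧ x v = t
  nov : ∀ e v, x (L e) < x v → x v < x (R e) →
    y (L e) + (x v - x (L e)) * ((y (R e) - y (L e)) / (x (R e) - x (L e))) ≠ y v

set_option linter.unusedSectionVars false

namespace PG

open scoped Classical

variable {V E : Type} (P : PG V E)

/-- height of the edge `e` over abscissa `t` -/
noncomputable def h (e : E) (t : ℝ) : ℝ :=
  P.y (P.L e) + (t - P.x (P.L e)) * ((P.y (P.R e) - P.y (P.L e)) / (P.x (P.R e) - P.x (P.L e)))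

/-- the abscissa `t` is strictly inside the range of `e` -/
def act (e : E) (t : ℝ) : Prop := P.x (P.L e) < t ∧ t < P.x (P.R e)

lemma h_L (e : E) : P.h e (P.x (P.L e)) = P.y (P.L e) := by simp [h]

lemma h_R (e : E) : P.h e (P.x (P.R e)) = P.y (P.R e) := by
  have := P.lt e
  have h2 : P.x (P.R e) - P.x (P.L e) ≠ 0 := by linarith
  simp only [h]
  field_simp
  ring

lemma h_aff (e : E) (s t r : ℝ) : P.h e ((1 - r) * s + r * t) = (1 - r) * P.h e s + r * P.h e t := by
  simp only [h]; ring

lemma no_eq {e e' : E} (hne : e ≠ e') {t : ℝ} (ha : P.act e t) (h1 : P.x (P.L e') ≤ t)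
    (h2 : t ≤ P.x (P.R e')) : P.h e t ≠ P.h e' t := by
  intro heq
  obtain ⟨v, hv, -, hx⟩ := P.noc e e' hne t ha.1.le ha.2.le h1 h2 heq
  rcases hv with rfl | rfl
  · exact absurd ha.1 (by linarith)
  · exact absurd ha.2 (by linarith)

/-- order preservation -/
lemma order {e e' : E} (hne : e ≠ e') {t t' : ℝ} (ha : P.act e t) (ha' : P.act e t')
    (h1 : P.x (P.L e') ≤ t) (h2 : t ≤ P.x (P.R e')) (h1' : P.x (P.L e') ≤ t')
    (h2' : t' ≤ P.x (P.R e')) : P.h e t < P.h e' t ↔ P.h e t' < P.h e' t' := by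
  have key : 0 < (P.h e' t - P.h e t) * (P.h e' t' - P.h e t') := by
    by_contra hcon
    push Not at hcon
    set A := P.h e' t - P.h e t with hA
    set B := P.h e' t' - P.h e t' with hB
    have hA0 : A ≠ 0 := by
      have := P.no_eq hne ha h1 h2
      intro h0; apply this; linarith
    -- zero at r = A / (A - B)
    have hAB : A ≠ B := by
      intro hab
      rw [← hab] at hcon
      have : 0 < A * A := mul_self_pos.2 hA0
      linarith
    have hAB' : A - B ≠ 0 := sub_ne_zero.mpr hAB
    set r := A / (A - B) with hr
    have hr0 : 0 ≤ r := by
      rw [hr]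
      rw [div_nonneg_iff]
      rcases lt_or_gt_of_ne hA0 with h0 | h0
      · right; refine ⟨h0.le, ?_⟩; nlinarith
      · left; refine ⟨h0.le, ?_⟩; nlinarith
    have hr1 : r ≤ 1 := by
      have : 1 - r = -B / (A - B) := by rw [hr]; field_simp; ring
      have h3 : 0 ≤ -B / (A - B) := by
        rw [div_nonneg_iff]
        rcases lt_or_gt_of_ne hA0 with h0 | h0
        · right; constructor <;> nlinarith
        · left; constructor <;> nlinarith
      linarith
    have hz : (1 - r) * A + r * B = 0 := by
      rw [hr]; field_simp; ring
    have q1 : 0 ≤ 1 - r := by linarith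
    have hact : P.act e ((1 - r) * t + r * t') := by
      have a1 := ha.1; have a2 := ha.2; have a3 := ha'.1; have a4 := ha'.2
      constructor
      · rcases hr0.eq_or_lt with h0 | h0
        · rw [← h0]; linarith
        · nlinarith
      · rcases hr0.eq_or_lt with h0 | h0
        · rw [← h0]; linarith
        · nlinarith
    refine P.no_eq hne hact (e' := e') (by nlinarith) (by nlinarith) ?_
    rw [h_aff, h_aff]
    have : (1 - r) * (P.h e' t - P.h e t) + r * (P.h e' t' - P.h e t') = 0 := hz
    linarith
  constructor
  · intro h0
    have : 0 < P.h e' t - P.h e t := by linarith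
    have := (pos_iff_pos_of_mul_pos key).1 this
    linarith
  · intro h0
    have : 0 < P.h e' t' - P.h e t' := by linarith
    have := (pos_iff_pos_of_mul_pos key).2 this
    linarith

lemma order' {e e' : E} (hne : e ≠ e') {t t' : ℝ} (ha : P.act e t) (ha' : P.act e t')
    (h1 : P.x (P.L e') ≤ t) (h2 : t ≤ P.x (P.R e')) (h1' : P.x (P.L e') ≤ t')
    (h2' : t' ≤ P.x (P.R e')) : P.h e' t < P.h e t ↔ P.h e' t' < P.h e t' := by
  have := P.order hne ha ha' h1 h2 h1' h2'
  have a := P.no_eq hne ha h1 h2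
  have b := P.no_eq hne ha' h1' h2'
  constructor
  · intro h0
    rcases lt_or_gt_of_ne b with h3 | h3
    · exact absurd (this.2 h3) (by linarith)
    · exact h3
  · intro h0
    rcases lt_or_gt_of_ne a with h3 | h3
    · exact absurd (this.1 h3) (by linarith)
    · exact h3

lemma order_act {e e' : E} {t t' : ℝ} (ha : P.act e t) (ha' : P.act e t')
    (hb : P.act e' t) (hb' : P.act e' t') : P.h e t < P.h e' t ↔ P.h e t' < P.h e' t' := by
  by_cases hne : e = e'
  · subst hne; simp
  · exact P.order hne ha ha' hb.1.le hb.2.le hb'.1.le hb'.2.le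

lemma act_inj {e e' : E} {t : ℝ} (ha : P.act e t) (hb : P.act e' t) (hh : P.h e t = P.h e' t) :
    e = e' := by
  by_contra hne
  exact P.no_eq hne ha hb.1.le hb.2.le hh

/-- topmost edge of a finite set at abscissa `t` -/
noncomputable def topm (t : ℝ) (S : Finset E) : Option E :=
  if hS : S.Nonempty then some (Finset.exists_max_image S (fun e => P.h e t) hS).choose else none

lemma topm_empty (t : ℝ) : P.topm t ∅ = none := by simp [topm]

lemma topm_spec (t : ℝ) {S : Finset E} (hS : S.Nonempty) :
    ∃ e ∈ S, P.topm t S = some e ∧ ∀ e' ∈ S, P.h e' t ≤ P.h e t := by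
  have := (Finset.exists_max_image S (fun e => P.h e t) hS).choose_spec
  exact ⟨_, this.1, by simp [topm, hS], this.2⟩

lemma topm_eq {t : ℝ} {S : Finset E} (hS : ∀ e ∈ S, P.act e t) {e : E} (he : e ∈ S)
    (hm : ∀ e' ∈ S, P.h e' t ≤ P.h e t) : P.topm t S = some e := by
  obtain ⟨e', he', h1, h2⟩ := P.topm_spec t ⟨e, he⟩
  rw [h1, P.act_inj (hS e' he') (hS e he) (le_antisymm (hm e' he') (h2 e he))]

lemma topm_congr {t t' : ℝ} {S : Finset E} (hS : ∀ e ∈ S, P.act e t) (hS' : ∀ e ∈ S, P.act e t') :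
    P.topm t S = P.topm t' S := by
  by_cases hne : S.Nonempty
  · obtain ⟨e', he', h1, h2⟩ := P.topm_spec t hne
    rw [h1]
    symm
    apply P.topm_eq hS' he'
    intro e he
    by_contra hcon
    push Not at hcon
    have := (P.order_act (hS' e' he') (hS e' he') (hS' e he) (hS e he)).1 hcon
    exact absurd (h2 e he) (by linarith)
  · rw [Finset.not_nonempty_iff_eq_empty] at hne
    subst hne
    simp [topm]

/-- `t` is not the abscissa of a vertex -/
def gen (t : ℝ) : Prop := ∀ v, P.x v ≠ t

variable [Fintype V] [Fintype E]

lemma exists_nbhd (v : V) : ∃ p : ℝ × ℝ, p.1 < P.x v ∧ P.x v < p.2 ∧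
    ∀ w, w ≠ v → P.x w < p.1 ∨ p.2 < P.x w := by
  by_cases hne : (Finset.univ.erase v).Nonempty
  · obtain ⟨w, hw, hmin⟩ := Finset.exists_min_image _ (fun w => |P.x w - P.x v|) hne
    have hwv : w ≠ v := Finset.ne_of_mem_erase hw
    have hpos : 0 < |P.x w - P.x v| := abs_pos.mpr (sub_ne_zero.mpr (fun h => hwv (P.xinj h)))
    refine ⟨(P.x v - |P.x w - P.x v| / 2, P.x v + |P.x w - P.x v| / 2), by dsimp only; linarith, by dsimp only; linarith, ?_⟩
    intro z hz
    have := hmin z (by simp [hz])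
    simp only at this ⊢
    rcases le_abs.1 this with h1 | h1
    · right; linarith
    · left; linarith
  · refine ⟨(P.x v - 1, P.x v + 1), by simp, by simp, fun w hw => ?_⟩
    exact absurd ⟨w, by simp [hw]⟩ hne

noncomputable def tm (v : V) : ℝ := (P.exists_nbhd v).choose.1
noncomputable def tp (v : V) : ℝ := (P.exists_nbhd v).choose.2
lemma tm_lt (v : V) : P.tm v < P.x v := (P.exists_nbhd v).choose_spec.1
lemma lt_tp (v : V) : P.x v < P.tp v := (P.exists_nbhd v).choose_spec.2.1
lemma nbhd (v w : V) (hw : w ≠ v) : P.x w < P.tm v ∨ P.tp v < P.x w :=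
  (P.exists_nbhd v).choose_spec.2.2 w hw

lemma gen_tm (v : V) : P.gen (P.tm v) := by
  intro w hw
  by_cases h : w = v
  · subst h; have := P.tm_lt w; linarith
  · have := P.tm_lt v; have := P.lt_tp v
    rcases P.nbhd v w h with h | h <;> linarith

lemma gen_tp (v : V) : P.gen (P.tp v) := by
  intro w hw
  by_cases h : w = v
  · subst h; have := P.lt_tp w; linarith
  · have := P.tm_lt v; have := P.lt_tp v
    rcases P.nbhd v w h with h | h <;> linarith

lemma exists_gen {a b : ℝ} (hab : a < b) : ∃ t, a < t ∧ t < b ∧ P.gen t := by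
  have hfin : (Set.range P.x).Finite := Set.finite_range _
  have hinf : (Set.Ioo a b).Infinite := Set.Ioo_infinite hab
  obtain ⟨t, ht, hn⟩ := hinf.exists_notMem_finite hfin
  exact ⟨t, ht.1, ht.2, fun v hv => hn ⟨v, hv⟩⟩

noncomputable def active (t : ℝ) : Finset E := Finset.univ.filter (fun e => P.act e t)

lemma mem_active {t : ℝ} {e : E} : e ∈ P.active t ↔ P.act e t := by simp [active]

/-- edges below the gap `g` at `t` (`none` is the unbounded gap at the top). -/
noncomputable def bel (t : ℝ) (g : Option E) : Finset E :=
  (P.active t).filter (fun e' => ∀ e, g = some e → P.h e' t < P.h e t)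

lemma mem_bel {t : ℝ} {g : Option E} {e' : E} :
    e' ∈ P.bel t g ↔ P.act e' t ∧ ∀ e, g = some e → P.h e' t < P.h e t := by
  simp [bel, mem_active]

noncomputable def pr (t : ℝ) (g : Option E) : Option E := P.topm t (P.bel t g)

/-- edges passing below the vertex `v` -/
noncomputable def pas (v : V) : Finset E :=
  (P.active (P.x v)).filter (fun e => P.h e (P.x v) < P.y v)

noncomputable def av (v : V) : Option E :=
  P.topm (P.tm v) (P.pas v ∪ Finset.univ.filter (fun e => P.R e = v))

noncomputable def bv (v : V) : Option E :=
  P.topm (P.tp v) (P.pas v ∪ Finset.univ.filter (fun e => P.L e = v))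

def rel (a b : Option E) : Prop := ∃ v, a = P.av v ∧ b = P.bv v

/-- faces -/
abbrev Face := Quot P.rel

noncomputable def fc (a : Option E) : P.Face := Quot.mk _ a

lemma fc_link (v : V) : P.fc (P.av v) = P.fc (P.bv v) := Quot.sound ⟨v, rfl, rfl⟩

lemma act_tm {v : V} {e : E} : P.act e (P.tm v) ↔ P.act e (P.x v) ∨ P.R e = v := by
  have h1 := P.tm_lt v
  have h2 := P.lt_tp v
  have h0 := P.lt e
  constructor
  · intro ⟨a, b⟩
    by_cases hR : P.R e = v
    · right; exact hR
    · left
      refine ⟨by linarith, ?_⟩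
      rcases P.nbhd v _ hR with h | h <;> linarith
  · rintro (⟨a, b⟩ | h)
    · refine ⟨?_, by linarith⟩
      have hL : P.L e ≠ v := by rintro rfl; linarith
      rcases P.nbhd v _ hL with h | h
      · exact h
      · linarith
    · have hL : P.L e ≠ v := by rintro h'; rw [h, h'] at h0; linarith
      rw [h] at h0
      refine ⟨?_, by rw [h]; exact h1⟩
      rcases P.nbhd v _ hL with h | h
      · exact h
      · linarith

lemma act_tp {v : V} {e : E} : P.act e (P.tp v) ↔ P.act e (P.x v) ∨ P.L e = v := by
  have h1 := P.tm_lt v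
  have h2 := P.lt_tp v
  have h0 := P.lt e
  constructor
  · intro ⟨a, b⟩
    by_cases hR : P.L e = v
    · right; exact hR
    · left
      refine ⟨?_, by linarith⟩
      rcases P.nbhd v _ hR with h | h <;> linarith
  · rintro (⟨a, b⟩ | h)
    · refine ⟨by linarith, ?_⟩
      have hL : P.R e ≠ v := by rintro rfl; linarith
      rcases P.nbhd v _ hL with h | h
      · linarith
      · exact h
    · have hL : P.R e ≠ v := by rintro h'; rw [h, h'] at h0; linarith
      rw [h] at h0
      refine ⟨by rw [h]; exact h2, ?_⟩
      rcases P.nbhd v _ hL with h | h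
      · linarith
      · exact h

lemma mem_pas {v : V} {e : E} : e ∈ P.pas v ↔ P.act e (P.x v) ∧ P.h e (P.x v) < P.y v := by
  simp [pas, mem_active]

/-- the abstract crossing step -/
lemma cross_aux (v : V) (g : Option E) (hg : ∀ e, g = some e → P.act e (P.x v))
    (t : ℝ) (Z : Finset E)
    (hact : ∀ e, P.act e t ↔ P.act e (P.x v) ∨ e ∈ Z)
    (hZ : ∀ e ∈ Z, P.x (P.L e) ≤ P.x v ∧ P.x v ≤ P.x (P.R e) ∧ P.h e (P.x v) = P.y v) :
    P.pr t g =
      if (∀ e, g = some e → P.y v < P.h e (P.x v)) ∧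
        (∀ e ∈ P.bel (P.x v) g, P.h e (P.x v) < P.y v) then P.topm t (P.pas v ∪ Z)
      else P.topm (P.x v) (P.bel (P.x v) g) := by
  -- comparison of a passing edge with an edge of Z
  have cmp : ∀ e z, P.act e (P.x v) → z ∈ Z → ((P.h z t < P.h e t ↔ P.y v < P.h e (P.x v)) ∧
      (P.h e t < P.h z t ↔ P.h e (P.x v) < P.y v)) := by
    intro e z he hz
    obtain ⟨a1, a2, a3⟩ := hZ z hz
    have het := (hact e).2 (Or.inl he)
    have hzt := (hact z).2 (Or.inr hz)
    have hne : e ≠ z := by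
      rintro rfl
      exact P.nov e v he.1 he.2 a3
    constructor
    · rw [← a3]; exact P.order' hne het he hzt.1.le hzt.2.le a1 a2
    · rw [← a3]; exact P.order hne het he hzt.1.le hzt.2.le a1 a2
  have cmp2 : ∀ e e', P.act e (P.x v) → P.act e' (P.x v) →
      (P.h e t < P.h e' t ↔ P.h e (P.x v) < P.h e' (P.x v)) := fun e e' he he' =>
    P.order_act ((hact e).2 (Or.inl he)) he ((hact e').2 (Or.inl he')) he'
  have hbx : ∀ e, e ∈ P.bel (P.x v) g → e ∈ P.bel t g := by
    intro e he
    rw [mem_bel] at he ⊢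
    refine ⟨(hact e).2 (Or.inl he.1), fun e' he' => ?_⟩
    rw [cmp2 e e' he.1 (hg e' he')]
    exact he.2 e' he'
  have hbx' : ∀ e, P.act e (P.x v) → e ∈ P.bel t g → e ∈ P.bel (P.x v) g := by
    intro e ha he
    rw [mem_bel] at he ⊢
    refine ⟨ha, fun e' he' => ?_⟩
    rw [← cmp2 e e' ha (hg e' he')]
    exact he.2 e' he'
  have hact_t : ∀ e ∈ P.bel t g, P.act e t := fun e he => (P.mem_bel.1 he).1
  split_ifs with hc
  · obtain ⟨hc1, hc2⟩ := hc
    unfold pr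
    congr 1
    ext e
    rw [Finset.mem_union, mem_pas]
    constructor
    · intro he
      rcases (hact e).1 (hact_t e he) with h | h
      · left; exact ⟨h, hc2 e (hbx' e h he)⟩
      · right; exact h
    · rintro (⟨h1, h2⟩ | hz)
      · rw [mem_bel]
        refine ⟨(hact e).2 (Or.inl h1), fun e' he' => ?_⟩
        rw [cmp2 e e' h1 (hg e' he')]
        exact h2.trans (hc1 e' he')
      · rw [mem_bel]
        refine ⟨(hact e).2 (Or.inr hz), fun e' he' => ?_⟩
        rw [(cmp e' e (hg e' he') hz).1]
        exact hc1 e' he'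
  · have hnov : ∀ e, P.act e (P.x v) → P.h e (P.x v) ≠ P.y v := fun e he => P.nov e v he.1 he.2
    by_cases hc1 : ∀ e, g = some e → P.y v < P.h e (P.x v)
    · -- some passing edge above v and below g
      have hc2 : ∃ e ∈ P.bel (P.x v) g, P.y v < P.h e (P.x v) := by
        by_contra hcon
        push Not at hcon
        exact hc ⟨hc1, fun e he => lt_of_le_of_ne (hcon e he) (hnov e (P.mem_bel.1 he).1)⟩
      obtain ⟨e0, he0, hy0⟩ := hc2
      obtain ⟨m, hm, htop, hmax⟩ := P.topm_spec (P.x v) ⟨e0, he0⟩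
      rw [htop]
      apply P.topm_eq hact_t (hbx m hm)
      intro e he
      have hmact := (P.mem_bel.1 hm).1
      have hym : P.y v < P.h m (P.x v) := hy0.trans_le (hmax e0 he0)
      rcases (hact e).1 (hact_t e he) with h | h
      · by_contra hcon
        push Not at hcon
        rw [cmp2 m e hmact h] at hcon
        exact absurd (hmax e (hbx' e h he)) (by linarith)
      · exact ((cmp m e hmact h).1.2 hym).le
    · push Not at hc1
      obtain ⟨e0, rfl, hle⟩ := hc1
      have ha0 := hg e0 rfl
      have hlt : P.h e0 (P.x v) < P.y v := lt_of_le_of_ne hle (hnov e0 ha0)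
      have hset : P.bel t (some e0) = P.bel (P.x v) (some e0) := by
        ext e
        refine ⟨fun he => ?_, hbx e⟩
        rcases (hact e).1 (hact_t e he) with h | h
        · exact hbx' e h he
        · exfalso
          have := (P.mem_bel.1 he).2 e0 rfl
          have h2 := (cmp e0 e ha0 h).2.2 hlt
          linarith
      unfold pr
      rw [hset]
      exact P.topm_congr (fun e he => (hact e).2 (Or.inl (P.mem_bel.1 he).1))
        (fun e he => (P.mem_bel.1 he).1)

lemma cross (v : V) (g : Option E) (hg : ∀ e, g = some e → P.act e (P.x v)) :
    P.fc (P.pr (P.tm v) g) = P.fc (P.pr (P.tp v) g) := by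
  have h1 := P.cross_aux v g hg (P.tm v) (Finset.univ.filter (fun e => P.R e = v))
    (fun e => by rw [act_tm]; simp) (by
      intro e he
      simp only [Finset.mem_filter, Finset.mem_univ, true_and] at he
      subst he
      exact ⟨(P.lt e).le, le_rfl, P.h_R e⟩)
  have h2 := P.cross_aux v g hg (P.tp v) (Finset.univ.filter (fun e => P.L e = v))
    (fun e => by rw [act_tp]; simp) (by
      intro e he
      simp only [Finset.mem_filter, Finset.mem_univ, true_and] at he
      subst he
      exact ⟨le_rfl, (P.lt e).le, P.h_L e⟩)
  rw [h1, h2]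
  split_ifs with hc
  · exact P.fc_link v
  · rfl

lemma same_slab {t t' : ℝ} (htt : t ≤ t') (hno : ∀ v, P.x v < t ∨ t' < P.x v) (g : Option E)
    (hg : ∀ e, g = some e → P.act e t) : P.pr t g = P.pr t' g := by
  have hact : ∀ e, P.act e t ↔ P.act e t' := by
    intro e
    have h1 := hno (P.L e)
    have h2 := hno (P.R e)
    constructor
    · rintro ⟨a, b⟩
      refine ⟨by linarith, ?_⟩
      rcases h2 with h | h <;> linarith
    · rintro ⟨a, b⟩
      refine ⟨?_, by linarith⟩
      rcases h1 with h | h <;> linarith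
  have hset : P.bel t g = P.bel t' g := by
    ext e
    rw [mem_bel, mem_bel, hact e]
    refine and_congr_right fun ha => forall_congr' fun e' => forall_congr' fun he' => ?_
    exact P.order_act ((hact e).2 ha) ha (hg e' he') ((hact e').1 (hg e' he'))
  unfold pr
  rw [hset]
  refine P.topm_congr (fun e he => (hact e).2 (P.mem_bel.1 he).1)
        (fun e he => (P.mem_bel.1 he).1)

lemma transport_aux (g : Option E) (n : ℕ) : ∀ t t' : ℝ, t ≤ t' → P.gen t → P.gen t' →
    (∀ e, g = some e → P.act e t) → (∀ e, g = some e → P.act e t') →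
    (Finset.univ.filter (fun v => t < P.x v ∧ P.x v < t')).card = n →
    P.fc (P.pr t g) = P.fc (P.pr t' g) := by
  induction n with
  | zero =>
    intro t t' htt h1 h2 hg hg' hn
    rw [P.same_slab htt _ g hg]
    intro v
    rw [Finset.card_eq_zero, Finset.filter_eq_empty_iff] at hn
    have := hn (Finset.mem_univ v)
    by_contra hcon
    push Not at hcon
    exact this ⟨lt_of_le_of_ne hcon.1 (h1 v).symm, lt_of_le_of_ne hcon.2 (h2 v)⟩
  | succ n ih =>
    intro t t' htt h1 h2 hg hg' hn
    have hne : (Finset.univ.filter (fun v => t < P.x v ∧ P.x v < t')).Nonempty := by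
      rw [← Finset.card_pos]; omega
    obtain ⟨v, hv, hmin⟩ := Finset.exists_min_image _ P.x hne
    simp only [Finset.mem_filter, Finset.mem_univ, true_and] at hv hmin
    -- may shrink the neighbourhood of v
    have hm := P.tm_lt v
    have hp := P.lt_tp v
    have hgv : ∀ e, g = some e → P.act e (P.x v) := fun e he =>
      ⟨(hg e he).1.trans hv.1, hv.2.trans (hg' e he).2⟩
    have hgm : ∀ e, g = some e → P.act e (P.tm v) := fun e he => P.act_tm.2 (Or.inl (hgv e he))
    have hgp : ∀ e, g = some e → P.act e (P.tp v) := fun e he => P.act_tp.2 (Or.inl (hgv e he))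
    have s1 : P.pr t g = P.pr (P.tm v) g := by
      rcases le_total t (P.tm v) with hl | hl
      · refine P.same_slab hl (fun w => ?_) g hg
        by_contra hcon
        push Not at hcon
        have hw1 : t < P.x w := lt_of_le_of_ne hcon.1 (h1 w).symm
        have := hmin w ⟨hw1, by linarith⟩
        linarith
      · refine (P.same_slab hl (fun w => ?_) g hgm).symm
        by_cases hwv : w = v
        · right; rw [hwv]; exact hv.1
        · rcases P.nbhd v w hwv with h | h
          · left; exact h
          · right; linarith
    rw [s1, P.cross v g hgv]
    rcases le_total (P.tp v) t' with hl | hl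
    · refine ih (P.tp v) t' hl (P.gen_tp v) h2 hgp hg' ?_
      have : Finset.univ.filter (fun w => P.tp v < P.x w ∧ P.x w < t') =
          (Finset.univ.filter (fun w => t < P.x w ∧ P.x w < t')).erase v := by
        ext w
        simp only [Finset.mem_filter, Finset.mem_univ, true_and, Finset.mem_erase]
        constructor
        · rintro ⟨a, b⟩
          refine ⟨?_, by linarith, b⟩
          rintro rfl; linarith
        · rintro ⟨a, b, c⟩
          refine ⟨?_, c⟩
          have := hmin w ⟨b, c⟩
          rcases P.nbhd v w a with h | h
          · linarith
          · exact h
      rw [this, Finset.card_erase_of_mem (by simp [hv]), hn]; rfl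
    · rw [P.same_slab hl (fun w => ?_) g hg']
      by_cases hwv : w = v
      · left; rw [hwv]; exact hv.2
      · rcases P.nbhd v w hwv with h | h
        · left; linarith
        · right; linarith

lemma transport (g : Option E) {t t' : ℝ} (h1 : P.gen t) (h2 : P.gen t')
    (hg : ∀ e, g = some e → P.act e t) (hg' : ∀ e, g = some e → P.act e t') :
    P.fc (P.pr t g) = P.fc (P.pr t' g) := by
  rcases le_total t t' with h | h
  · exact P.transport_aux g _ t t' h h1 h2 hg hg' rfl
  · exact (P.transport_aux g _ t' t h h2 h1 hg' hg rfl).symm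

noncomputable def tg (e : E) : ℝ := (P.exists_gen (P.lt e)).choose
lemma tg_gen (e : E) : P.gen (P.tg e) := (P.exists_gen (P.lt e)).choose_spec.2.2
lemma tg_act (e : E) : P.act e (P.tg e) :=
  ⟨(P.exists_gen (P.lt e)).choose_spec.1, (P.exists_gen (P.lt e)).choose_spec.2.1⟩

noncomputable def up (e : E) : P.Face := P.fc (some e)
noncomputable def low (e : E) : P.Face := P.fc (P.pr (P.tg e) (some e))
noncomputable def out : P.Face := P.fc none

lemma low_eq {e : E} {t : ℝ} (ht : P.gen t) (ha : P.act e t) : P.low e = P.fc (P.pr t (some e)) :=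
  P.transport (some e) (P.tg_gen e) ht (by rintro _ ⟨⟩; exact P.tg_act e) (by rintro _ ⟨⟩; exact ha)

/-- telescoping -/
lemma telescope {t : ℝ} (ht : P.gen t) (g : P.Face → ℤ) (n : ℕ) : ∀ S : Finset E, S.card = n →
    (∀ e ∈ S, P.act e t) →
    (∀ e ∈ S, ∀ e', P.act e' t → P.h e' t < P.h e t → e' ∈ S) →
    ∑ e ∈ S, (g (P.up e) - g (P.low e)) = g (P.fc (P.topm t S)) - g P.out := by
  induction n with
  | zero =>
    intro S hS _ _
    rw [Finset.card_eq_zero] at hS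
    subst hS
    simp [topm_empty, out]
  | succ n ih =>
    intro S hS ha hd
    have hne : S.Nonempty := by rw [← Finset.card_pos]; omega
    obtain ⟨m, hm, htop, hmax⟩ := P.topm_spec t hne
    have hset : S.erase m = P.bel t (some m) := by
      ext e
      rw [Finset.mem_erase, mem_bel]
      constructor
      · rintro ⟨h1, h2⟩
        refine ⟨ha e h2, ?_⟩
        rintro _ ⟨⟩
        exact lt_of_le_of_ne (hmax e h2) (fun h => h1 (P.act_inj (ha e h2) (ha m hm) h))
      · rintro ⟨h1, h2⟩
        have := h2 m rfl
        exact ⟨by rintro rfl; linarith, hd m hm e h1 this⟩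
    rw [← Finset.add_sum_erase S _ hm, ih (S.erase m) (by rw [Finset.card_erase_of_mem hm]; omega)
      (fun e he => ha e (Finset.mem_of_mem_erase he)) ?_, htop, P.low_eq ht (ha m hm)]
    · rw [hset]
      unfold up pr
      ring
    · intro e he e' h1 h2
      rw [hset] at he ⊢
      rw [mem_bel] at he ⊢
      refine ⟨h1, fun e'' h'' => h2.trans (he.2 e'' h'')⟩

lemma card_face : Fintype.card E + 1 ≤ Nat.card P.Face + Fintype.card V := by
  classical
  let φ : (Option E → ℚ) →ₗ[ℚ] (V → ℚ) :=
    { toFun := fun f v => f (P.av v) - f (P.bv v)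
      map_add' := by intro f g; ext v; simp; ring
      map_smul' := by intro c f; ext v; simp; ring }
  have hrn := φ.finrank_range_add_finrank_ker
  have h1 : Module.finrank ℚ (LinearMap.range φ) ≤ Fintype.card V := by
    have := Submodule.finrank_le (LinearMap.range φ)
    simpa using this
  let ψ : LinearMap.ker φ →ₗ[ℚ] (P.Face → ℚ) :=
    { toFun := fun f => Quot.lift f.1 (by
        rintro a b ⟨v, rfl, rfl⟩
        have := congrFun (LinearMap.mem_ker.1 f.2) v
        simp only [φ, LinearMap.coe_mk, AddHom.coe_mk, Pi.zero_apply] at this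
        linarith)
      map_add' := by
        intro f g; ext q; induction q using Quot.ind; rfl
      map_smul' := by
        intro c f; ext q; induction q using Quot.ind; rfl }
  have hinj : Function.Injective ψ := by
    intro f g hfg
    ext a
    have := congrFun hfg (Quot.mk _ a)
    exact this
  have : Finite P.Face := Quot.finite _
  have : Fintype P.Face := Fintype.ofFinite _
  have h2 := LinearMap.finrank_le_finrank_of_injective hinj
  rw [Module.finrank_pi] at h2
  rw [Module.finrank_pi, Fintype.card_option] at hrn
  rw [Nat.card_eq_fintype_card]
  omega

end PG

set_option linter.unusedSectionVars false

namespace PG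
open scoped Classical
variable {V E : Type} (P : PG V E)

/-- adjacency of vertices -/
def adj (u v : V) : Prop := ∃ e, (P.L e = u ∧ P.R e = v) ∨ (P.L e = v ∧ P.R e = u)

/-- A parallelogram all of whose sides are edges: `e1`, `e2` are the lower sides,
`f1`, `f2` are the upper sides opposite to them. -/
structure Rh where
  e1 : E
  e2 : E
  f1 : E
  f2 : E
  ha : P.L e1 = P.L f2
  hb : P.R e1 = P.L e2
  hc : P.R e2 = P.R f1
  hd : P.R f2 = P.L f1
  hx : P.x (P.L e1) + P.x (P.R e2) = P.x (P.R e1) + P.x (P.R f2)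
  hy : P.y (P.L e1) + P.y (P.R e2) = P.y (P.R e1) + P.y (P.R f2)
  hcr : 0 < (P.x (P.R e1) - P.x (P.L e1)) * (P.y (P.R f2) - P.y (P.L e1)) -
    (P.y (P.R e1) - P.y (P.L e1)) * (P.x (P.R f2) - P.x (P.L e1))

/-- the open parallelogram -/
def Rh.ins {P : PG V E} (r : P.Rh) (t Y : ℝ) : Prop := ∃ a b : ℝ, 0 < a ∧ a < 1 ∧ 0 < b ∧ b < 1 ∧
  t = P.x (P.L r.e1) + a * (P.x (P.R r.e1) - P.x (P.L r.e1)) +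
    b * (P.x (P.R r.f2) - P.x (P.L r.e1)) ∧
  Y = P.y (P.L r.e1) + a * (P.y (P.R r.e1) - P.y (P.L r.e1)) +
    b * (P.y (P.R r.f2) - P.y (P.L r.e1))

variable [Fintype V] [Fintype E]

noncomputable def ind (φ : P.Face) (q : P.Face) : ℤ := if q = φ then 1 else 0

noncomputable def w (φ : P.Face) (e : E) : ℤ := P.ind φ (P.up e) - P.ind φ (P.low e)

noncomputable def d (φ : P.Face) : ℕ :=
  (Finset.univ.filter (fun e => P.up e = φ)).card + (Finset.univ.filter (fun e => P.low e = φ)).card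

/-- edges below the point `(t, Y)` -/
noncomputable def un (t Y : ℝ) : Finset E := (P.active t).filter (fun e => P.h e t < Y)

noncomputable def cell (t Y : ℝ) : P.Face := P.fc (P.topm t (P.un t Y))

lemma sum_un {φ : P.Face} (hφ : φ ≠ P.out) {t : ℝ} (ht : P.gen t) (Y : ℝ) :
    ∑ e ∈ P.un t Y, P.w φ e = P.ind φ (P.cell t Y) := by
  have := P.telescope ht (P.ind φ) _ (P.un t Y) rfl (by
    intro e he; simp only [un, Finset.mem_filter, mem_active] at he; exact he.1) (by
    intro e he e' h1 h2
    simp only [un, Finset.mem_filter, mem_active] at he ⊢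
    exact ⟨h1, h2.trans he.2⟩)
  unfold w
  rw [this]
  have : P.ind φ P.out = 0 := by simp [ind, hφ.symm]
  rw [this, cell]; ring

lemma pr_none {t : ℝ} (ht : P.gen t) : P.fc (P.pr t none) = P.out := by
  obtain ⟨m, hm⟩ : ∃ m, ∀ v, m ≤ P.x v := by
    obtain ⟨m, hm⟩ := (Set.finite_range P.x).bddBelow
    exact ⟨m, fun v => hm ⟨v, rfl⟩⟩
  have h1 : P.gen (m - 1) := fun v hv => by have := hm v; linarith
  rw [P.transport none ht h1 (by simp) (by simp)]
  have : P.bel (m - 1) none = ∅ := by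
    ext e
    simp only [mem_bel, Finset.notMem_empty, iff_false]
    rintro ⟨⟨h, -⟩, -⟩
    have := hm (P.L e)
    linarith
  rw [pr, this, topm_empty]; rfl

lemma sum_active {φ : P.Face} (hφ : φ ≠ P.out) {t : ℝ} (ht : P.gen t) :
    ∑ e ∈ P.active t, P.w φ e = 0 := by
  have := P.telescope ht (P.ind φ) _ (P.active t) rfl (by
    intro e he; exact P.mem_active.1 he) (by
    intro e he e' h1 h2
    exact P.mem_active.2 h1)
  unfold w
  rw [this]
  have h2 : P.active t = P.bel t none := by ext e; simp [mem_bel, mem_active]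
  rw [h2]
  have := P.pr_none ht
  unfold pr at this
  rw [this]; ring

lemma balance {φ : P.Face} (hφ : φ ≠ P.out) (v : V) :
    ∑ e ∈ Finset.univ.filter (fun e => P.R e = v), P.w φ e =
    ∑ e ∈ Finset.univ.filter (fun e => P.L e = v), P.w φ e := by
  have h1 := P.sum_active hφ (P.gen_tm v)
  have h2 := P.sum_active hφ (P.gen_tp v)
  have e1 : P.active (P.tm v) = P.active (P.x v) ∪ Finset.univ.filter (fun e => P.R e = v) := by
    ext e; simp [mem_active, act_tm]
  have e2 : P.active (P.tp v) = P.active (P.x v) ∪ Finset.univ.filter (fun e => P.L e = v) := by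
    ext e; simp [mem_active, act_tp]
  rw [e1, Finset.sum_union] at h1
  · rw [e2, Finset.sum_union] at h2
    · linarith
    · rw [Finset.disjoint_left]
      intro e he he'
      simp only [mem_active, Finset.mem_filter, Finset.mem_univ, true_and] at he he'
      have := he.1
      rw [he'] at this; linarith
  · rw [Finset.disjoint_left]
    intro e he he'
    simp only [mem_active, Finset.mem_filter, Finset.mem_univ, true_and] at he he'
    have := he.2
    rw [he'] at this; linarith

lemma w_vals (φ : P.Face) (e : E) : P.w φ e = 0 ∨ P.w φ e = 1 ∨ P.w φ e = -1 := by
  unfold w ind; split_ifs <;> simp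

lemma w_one {φ : P.Face} {e : E} (h : P.w φ e = 1) : P.up e = φ := by
  unfold w ind at h; split_ifs at h <;> simp_all

lemma w_neg {φ : P.Face} {e : E} (h : P.w φ e = -1) : P.low e = φ := by
  unfold w ind at h; split_ifs at h <;> simp_all

lemma exists_w {φ : P.Face} (hφ : φ ≠ P.out) : ∃ e, P.w φ e ≠ 0 := by
  induction φ using Quot.ind with
  | mk o =>
  cases o with
  | none => exact absurd rfl hφ
  | some e0 =>
    by_contra hcon
    push Not at hcon
    unfold w at hcon
    have ht := P.tg_gen e0
    have ha := P.tg_act e0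
    have := P.telescope ht (P.ind (Quot.mk _ (some e0))) _
      ((P.active (P.tg e0)).filter (fun e => P.h e (P.tg e0) ≤ P.h e0 (P.tg e0))) rfl (by
      intro e he; simp only [Finset.mem_filter, mem_active] at he; exact he.1) (by
      intro e he e' h1 h2
      simp only [Finset.mem_filter, mem_active] at he ⊢
      exact ⟨h1, h2.le.trans he.2⟩)
    rw [P.topm_eq (e := e0) (by
      intro e he; simp only [Finset.mem_filter, mem_active] at he; exact he.1) (by simp [mem_active, ha]) (by
      intro e he; simp only [Finset.mem_filter, mem_active] at he; exact he.2)] at this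
    rw [Finset.sum_eq_zero (fun e _ => hcon e)] at this
    have h1 : P.ind (Quot.mk _ (some e0)) P.out = 0 := by
      unfold ind; rw [if_neg]; exact fun h => hφ h.symm
    have h2 : P.ind (Quot.mk _ (some e0)) (P.fc (some e0)) = 1 := by
      unfold ind; rw [if_pos]; rfl
    rw [h1, h2] at this
    simp at this

/-- oriented boundary darts -/
def dart (φ : P.Face) (e : E) (u v : V) : Prop :=
  (P.L e = u ∧ P.R e = v ∧ P.w φ e = 1) ∨ (P.R e = u ∧ P.L e = v ∧ P.w φ e = -1)

lemma dart_adj {φ : P.Face} {e : E} {u v : V} (h : P.dart φ e u v) : P.adj u v := by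
  rcases h with ⟨a, b, -⟩ | ⟨a, b, -⟩
  · exact ⟨e, Or.inl ⟨a, b⟩⟩
  · exact ⟨e, Or.inr ⟨b, a⟩⟩

lemma dart_ne {φ : P.Face} {e : E} {u v : V} (h : P.dart φ e u v) : u ≠ v := by
  have := P.lt e
  rintro rfl
  rcases h with ⟨a, b, -⟩ | ⟨a, b, -⟩ <;> rw [a, b] at this <;> linarith

lemma dart_w {φ : P.Face} {e : E} {u v : V} (h : P.dart φ e u v) : P.w φ e ≠ 0 := by
  rcases h with ⟨a, b, c⟩ | ⟨a, b, c⟩ <;> rw [c] <;> simp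

lemma dart_src {φ : P.Face} {e : E} {u v u' v' : V} (h : P.dart φ e u v) (h' : P.dart φ e u' v') :
    u = u' ∧ v = v' := by
  rcases h with ⟨a, b, c⟩ | ⟨a, b, c⟩ <;> rcases h' with ⟨a', b', c'⟩ | ⟨a', b', c'⟩
  · exact ⟨a.symm.trans a', b.symm.trans b'⟩
  · rw [c] at c'; simp at c'
  · rw [c] at c'; simp at c'
  · exact ⟨a.symm.trans a', b.symm.trans b'⟩

lemma dart_anti {φ : P.Face} {e e' : E} {u v : V} (h : P.dart φ e u v) (h' : P.dart φ e' v u) :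
    False := by
  have l1 := P.lt e
  have l2 := P.lt e'
  rcases h with ⟨a, b, c⟩ | ⟨a, b, c⟩ <;> rcases h' with ⟨a', b', c'⟩ | ⟨a', b', c'⟩
  · rw [a, b] at l1; rw [a', b'] at l2; linarith
  · have := P.ext e e' (a.trans b'.symm) (b.trans a'.symm)
    subst this; rw [c] at c'; simp at c'
  · have := P.ext e e' (b.trans a'.symm) (a.trans b'.symm)
    subst this; rw [c] at c'; simp at c'
  · rw [a, b] at l1; rw [a', b'] at l2; linarith

lemma dart_exists {φ : P.Face} {e : E} (h : P.w φ e ≠ 0) : ∃ u v, P.dart φ e u v := by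
  rcases P.w_vals φ e with h1 | h1 | h1
  · exact absurd h1 h
  · exact ⟨_, _, Or.inl ⟨rfl, rfl, h1⟩⟩
  · exact ⟨_, _, Or.inr ⟨rfl, rfl, h1⟩⟩

lemma dart_next {φ : P.Face} (hφ : φ ≠ P.out) {e : E} {u v : V} (h : P.dart φ e u v) :
    ∃ e' z, P.dart φ e' v z := by
  by_contra hcon
  push Not at hcon
  have hb := P.balance hφ v
  have hL : ∀ f, P.L f = v → P.w φ f ≤ 0 := by
    intro f hf
    rcases P.w_vals φ f with h1 | h1 | h1
    · omega
    · exact absurd (Or.inl ⟨hf, rfl, h1⟩) (hcon f (P.R f))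
    · omega
  have hR : ∀ f, P.R f = v → 0 ≤ P.w φ f := by
    intro f hf
    rcases P.w_vals φ f with h1 | h1 | h1
    · omega
    · omega
    · exact absurd (Or.inr ⟨hf, rfl, h1⟩) (hcon f (P.L f))
  have sL : ∑ e ∈ Finset.univ.filter (fun e => P.L e = v), P.w φ e ≤ 0 :=
    Finset.sum_nonpos (fun f hf => hL f (by simpa using hf))
  have sR : 0 ≤ ∑ e ∈ Finset.univ.filter (fun e => P.R e = v), P.w φ e :=
    Finset.sum_nonneg (fun f hf => hR f (by simpa using hf))
  rcases h with ⟨a, b, c⟩ | ⟨a, b, c⟩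
  · have : P.w φ e ≤ ∑ e ∈ Finset.univ.filter (fun e => P.R e = v), P.w φ e :=
      Finset.single_le_sum (f := fun e => P.w φ e) (fun f hf => hR f (by simpa using hf)) (by simp [b])
    omega
  · have : ∑ e ∈ Finset.univ.filter (fun e => P.L e = v), P.w φ e < 0 := by
      refine Finset.sum_neg' (fun f hf => hL f (by simpa using hf)) ⟨e, by simp [b], by rw [c]; simp⟩
    omega

lemma card_w_le (φ : P.Face) : (Finset.univ.filter (fun e => P.w φ e ≠ 0)).card ≤ P.d φ := by
  unfold d
  refine le_trans (Finset.card_le_card ?_) (Finset.card_union_le _ _)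
  intro e he
  simp only [Finset.mem_filter, Finset.mem_univ, true_and, Finset.mem_union] at he ⊢
  rcases P.w_vals φ e with h1 | h1 | h1
  · exact absurd h1 he
  · left; exact P.w_one h1
  · right; exact P.w_neg h1

/-- four consecutive darts with distinct sources -/
lemma four_darts (tri : ∀ u v z, P.adj u v → P.adj v z → P.adj z u → False)
    {φ : P.Face} (hφ : φ ≠ P.out) : ∃ e0 e1 e2 e3 v0 v1 v2 v3 v4,
    P.dart φ e0 v0 v1 ∧ P.dart φ e1 v1 v2 ∧ P.dart φ e2 v2 v3 ∧ P.dart φ e3 v3 v4 ∧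
    v0 ≠ v2 ∧ v1 ≠ v3 ∧ v0 ≠ v3 ∧ v1 ≠ v4 ∧ v2 ≠ v4 := by
  obtain ⟨e0, he0⟩ := P.exists_w hφ
  obtain ⟨v0, v1, h0⟩ := P.dart_exists he0
  obtain ⟨e1, v2, h1⟩ := P.dart_next hφ h0
  obtain ⟨e2, v3, h2⟩ := P.dart_next hφ h1
  obtain ⟨e3, v4, h3⟩ := P.dart_next hφ h2
  refine ⟨e0, e1, e2, e3, v0, v1, v2, v3, v4, h0, h1, h2, h3, ?_, ?_, ?_, ?_, ?_⟩
  · rintro rfl; exact P.dart_anti h0 h1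
  · rintro rfl; exact P.dart_anti h1 h2
  · rintro rfl; exact tri _ _ _ (P.dart_adj h0) (P.dart_adj h1) (P.dart_adj h2)
  · rintro rfl; exact tri _ _ _ (P.dart_adj h1) (P.dart_adj h2) (P.dart_adj h3)
  · rintro rfl; exact P.dart_anti h2 h3

lemma four_le (tri : ∀ u v z, P.adj u v → P.adj v z → P.adj z u → False)
    {φ : P.Face} (hφ : φ ≠ P.out) : 4 ≤ P.d φ ∧ (P.d φ = 4 → ∃ e0 e1 e2 e3 v0 v1 v2 v3,
    P.dart φ e0 v0 v1 ∧ P.dart φ e1 v1 v2 ∧ P.dart φ e2 v2 v3 ∧ P.dart φ e3 v3 v0 ∧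
    v0 ≠ v2 ∧ v1 ≠ v3 ∧ ∀ e, P.w φ e ≠ 0 → e = e0 ∨ e = e1 ∨ e = e2 ∨ e = e3) := by
  obtain ⟨e0, e1, e2, e3, v0, v1, v2, v3, v4, h0, h1, h2, h3, n02, n13, n03, n14, n24⟩ :=
    P.four_darts tri hφ
  have hsub : ({e0, e1, e2, e3} : Finset E) ⊆ Finset.univ.filter (fun e => P.w φ e ≠ 0) := by
    intro e he
    simp only [Finset.mem_insert, Finset.mem_singleton] at he
    simp only [Finset.mem_filter, Finset.mem_univ, true_and]
    rcases he with rfl | rfl | rfl | rfl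
    · exact P.dart_w h0
    · exact P.dart_w h1
    · exact P.dart_w h2
    · exact P.dart_w h3
  have d01 : e0 ≠ e1 := by rintro rfl; exact P.dart_ne h0 (P.dart_src h0 h1).1
  have d02 : e0 ≠ e2 := by rintro rfl; exact n02 (P.dart_src h0 h2).1
  have d03 : e0 ≠ e3 := by rintro rfl; exact n03 (P.dart_src h0 h3).1
  have d12 : e1 ≠ e2 := by rintro rfl; exact P.dart_ne h1 (P.dart_src h1 h2).1
  have d13 : e1 ≠ e3 := by rintro rfl; exact n13 (P.dart_src h1 h3).1
  have d23 : e2 ≠ e3 := by rintro rfl; exact P.dart_ne h2 (P.dart_src h2 h3).1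
  have hcard : ({e0, e1, e2, e3} : Finset E).card = 4 := by
    rw [Finset.card_insert_of_notMem (by simp [*]), Finset.card_insert_of_notMem (by simp [*]),
      Finset.card_insert_of_notMem (by simp [*]), Finset.card_singleton]
  have hw := P.card_w_le φ
  have h4 := Finset.card_le_card hsub
  refine ⟨by omega, fun hd => ?_⟩
  have heq := Finset.eq_of_subset_of_card_le hsub (by omega)
  have hall : ∀ e, P.w φ e ≠ 0 → e = e0 ∨ e = e1 ∨ e = e2 ∨ e = e3 := by
    intro e he
    have : e ∈ Finset.univ.filter (fun e => P.w φ e ≠ 0) := by simp [he]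
    rw [← heq] at this
    simpa using this
  obtain ⟨e4, v5, h5⟩ := P.dart_next hφ h3
  have hv : v4 = v0 := by
    rcases hall e4 (P.dart_w h5) with rfl | rfl | rfl | rfl
    · exact (P.dart_src h5 h0).1
    · exact absurd (P.dart_src h5 h1).1.symm n14
    · exact absurd (P.dart_src h5 h2).1.symm n24
    · exact absurd (P.dart_src h5 h3).1.symm (P.dart_ne h3)
  subst hv
  exact ⟨e0, e1, e2, e3, v4, v1, v2, v3, h0, h1, h2, h3, n02, n13, hall⟩

end PG

set_option linter.unusedSectionVars false

namespace PG
open scoped Classical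
variable {V E : Type} (P : PG V E)

lemma Rh.e1_ne_e2 {P : PG V E} (r : P.Rh) : r.e1 ≠ r.e2 := by
  intro h
  have h1 := P.lt r.e1
  rw [r.hb, ← h] at h1
  exact lt_irrefl _ h1

lemma Rh.f1_ne_f2 {P : PG V E} (r : P.Rh) : r.f1 ≠ r.f2 := by
  intro h
  have h1 := P.lt r.f1
  rw [← r.hd, ← h] at h1
  exact lt_irrefl _ h1

lemma Rh.ins_open {P : PG V E} (r : P.Rh) {t Y : ℝ} (h : r.ins t Y) :
    ∀ᶠ t' in nhds t, r.ins t' Y := by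
  obtain ⟨a, b, ha, ha1, hb, hb1, ht, hY⟩ := h
  have hcr := r.hcr
  set u1 := P.x (P.R r.e1) - P.x (P.L r.e1)
  set u2 := P.y (P.R r.e1) - P.y (P.L r.e1)
  set v1 := P.x (P.R r.f2) - P.x (P.L r.e1)
  set v2 := P.y (P.R r.f2) - P.y (P.L r.e1)
  set κ := u1 * v2 - u2 * v1 with hκ
  have cA : Continuous (fun t' : ℝ => a + (t' - t) * v2 / κ) := by fun_prop
  have cB : Continuous (fun t' : ℝ => b - (t' - t) * u2 / κ) := by fun_prop
  have e1 := (cA.tendsto t).eventually (eventually_gt_nhds (b := 0) (by simpa using ha))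
  have e2 := (cA.tendsto t).eventually (eventually_lt_nhds (b := 1) (by simpa using ha1))
  have e3 := (cB.tendsto t).eventually (eventually_gt_nhds (b := 0) (by simpa using hb))
  have e4 := (cB.tendsto t).eventually (eventually_lt_nhds (b := 1) (by simpa using hb1))
  filter_upwards [e1, e2, e3, e4] with t' h1 h2 h3 h4
  refine ⟨a + (t' - t) * v2 / κ, b - (t' - t) * u2 / κ, h1, h2, h3, h4, ?_, ?_⟩
  · change t' = P.x (P.L r.e1) + _ * u1 + _ * v1
    have : (a + (t' - t) * v2 / κ) * u1 + (b - (t' - t) * u2 / κ) * v1 =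
      a * u1 + b * v1 + (t' - t) := by
      have : (t' - t) * v2 / κ * u1 - (t' - t) * u2 / κ * v1 = (t' - t) := by
        field_simp; rw [hκ]; ring
      linarith
    linarith
  · change Y = P.y (P.L r.e1) + _ * u2 + _ * v2
    rw [hY]; ring

lemma Rh.h_vals {P : PG V E} (r : P.Rh) {t Y : ℝ} (h : r.ins t Y) :
    P.x (P.L r.e1) < t ∧ t < P.x (P.R r.e2) ∧
    P.h r.e1 t < Y ∧ P.h r.e2 t < Y ∧ Y < P.h r.f1 t ∧ Y < P.h r.f2 t := by
  obtain ⟨a, b, ha, ha1, hb, hb1, ht, hY⟩ := h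
  have hcr := r.hcr
  have l1 := P.lt r.e1
  have l2 := P.lt r.f2
  have hx := r.hx
  have hy := r.hy
  unfold PG.h
  rw [← r.hb, ← r.hc, ← r.hd, ← r.ha]
  rw [← r.ha] at l2
  set x0 := P.x (P.L r.e1)
  set x1 := P.x (P.R r.e1)
  set x2 := P.x (P.R r.e2)
  set x3 := P.x (P.R r.f2)
  set y0 := P.y (P.L r.e1)
  set y1 := P.y (P.R r.e1)
  set y2 := P.y (P.R r.e2)
  set y3 := P.y (P.R r.f2)
  obtain ⟨u1, hu1⟩ : ∃ u, u = x1 - x0 := ⟨_, rfl⟩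
  obtain ⟨u2, hu2⟩ : ∃ u, u = y1 - y0 := ⟨_, rfl⟩
  obtain ⟨v1, hv1⟩ : ∃ u, u = x3 - x0 := ⟨_, rfl⟩
  obtain ⟨v2, hv2⟩ : ∃ u, u = y3 - y0 := ⟨_, rfl⟩
  have pu : 0 < u1 := by linarith
  have pv : 0 < v1 := by linarith
  have q1 : x2 - x1 = v1 := by linarith
  have q2 : y2 - y1 = v2 := by linarith
  have q3 : x2 - x3 = u1 := by linarith
  have q4 : y2 - y3 = u2 := by linarith
  rw [q1, q2, q3, q4, ← hu1, ← hu2, ← hv1, ← hv2]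
  rw [← hu1, ← hu2, ← hv1, ← hv2] at hcr
  rw [← hu1, ← hv1] at ht
  rw [← hu2, ← hv2] at hY
  have m1 : 0 < a * u1 := by positivity
  have m2 : 0 < b * v1 := by positivity
  have m3 : 0 < (1 - a) * u1 := mul_pos (by linarith) pu
  have m4 : 0 < (1 - b) * v1 := mul_pos (by linarith) pv
  have s1 : 0 < b * ((u1 * v2 - u2 * v1) / u1) := by positivity
  have s2 : 0 < (1 - a) * ((u1 * v2 - u2 * v1) / v1) := mul_pos (by linarith) (by positivity)
  have s3 : 0 < (1 - b) * ((u1 * v2 - u2 * v1) / u1) := mul_pos (by linarith) (by positivity)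
  have s4 : 0 < a * ((u1 * v2 - u2 * v1) / v1) := by positivity
  refine ⟨by linarith, by linarith, ?_, ?_, ?_, ?_⟩
  · have : Y - (y0 + (t - x0) * (u2 / u1)) = b * ((u1 * v2 - u2 * v1) / u1) := by
      rw [ht, hY]; field_simp; ring
    linarith
  · have : Y - (y1 + (t - x1) * (v2 / v1)) = (1 - a) * ((u1 * v2 - u2 * v1) / v1) := by
      have : t - x1 = (a - 1) * u1 + b * v1 := by linarith
      have e : y1 = y0 + u2 := by linarith
      rw [this, hY, e]; field_simp; ring
    linarith
  · have : (y3 + (t - x3) * (u2 / u1)) - Y = (1 - b) * ((u1 * v2 - u2 * v1) / u1) := by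
      have : t - x3 = a * u1 + (b - 1) * v1 := by linarith
      have e : y3 = y0 + v2 := by linarith
      rw [this, hY, e]; field_simp; ring
    linarith
  · have : (y0 + (t - x0) * (v2 / v1)) - Y = a * ((u1 * v2 - u2 * v1) / v1) := by
      rw [ht, hY]; field_simp; ring
    linarith

variable [Fintype V] [Fintype E]

lemma mem_un {t Y : ℝ} {e : E} : e ∈ P.un t Y ↔ P.act e t ∧ P.h e t < Y := by
  simp [un, mem_active]

lemma ind_nonneg (φ q : P.Face) : 0 ≤ P.ind φ q := by unfold ind; split_ifs <;> simp

/-- `r` is the boundary of the face `φ` -/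
def bdry (φ : P.Face) (r : P.Rh) : Prop :=
  P.w φ r.e1 = 1 ∧ P.w φ r.e2 = 1 ∧ P.w φ r.f1 = -1 ∧ P.w φ r.f2 = -1 ∧
  ∀ e, P.w φ e ≠ 0 → e = r.e1 ∨ e = r.e2 ∨ e = r.f1 ∨ e = r.f2

lemma rh_core {φ : P.Face} (hφ : φ ≠ P.out) {e0 e1 e2 e3 : E} {v0 v1 v2 v3 : V}
    (h0 : P.dart φ e0 v0 v1) (h1 : P.dart φ e1 v1 v2) (h2 : P.dart φ e2 v2 v3)
    (h3 : P.dart φ e3 v3 v0) (l1 : P.x v0 < P.x v1) (l3 : P.x v0 < P.x v3)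
    (hx : P.x v0 + P.x v2 = P.x v1 + P.x v3) (hy : P.y v0 + P.y v2 = P.y v1 + P.y v3)
    (hall : ∀ e, P.w φ e ≠ 0 → e = e0 ∨ e = e1 ∨ e = e2 ∨ e = e3) :
    ∃ r : P.Rh, P.bdry φ r := by
  have k0 : P.L e0 = v0 ∧ P.R e0 = v1 ∧ P.w φ e0 = 1 := by
    rcases h0 with h | ⟨a, b, c⟩
    · exact h
    · have := P.lt e0; rw [a, b] at this; linarith
  have k1 : P.L e1 = v1 ∧ P.R e1 = v2 ∧ P.w φ e1 = 1 := by
    rcases h1 with h | ⟨a, b, c⟩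
    · exact h
    · have := P.lt e1; rw [a, b] at this; linarith
  have k2 : P.R e2 = v2 ∧ P.L e2 = v3 ∧ P.w φ e2 = -1 := by
    rcases h2 with ⟨a, b, c⟩ | h
    · have := P.lt e2; rw [a, b] at this; linarith
    · exact h
  have k3 : P.R e3 = v3 ∧ P.L e3 = v0 ∧ P.w φ e3 = -1 := by
    rcases h3 with ⟨a, b, c⟩ | h
    · have := P.lt e3; rw [a, b] at this; linarith
    · exact h
  obtain ⟨a0, b0, c0⟩ := k0
  obtain ⟨a1, b1, c1⟩ := k1
  obtain ⟨a2, b2, c2⟩ := k2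
  obtain ⟨a3, b3, c3⟩ := k3
  have ne : e0 ≠ e3 := by rintro rfl; rw [c0] at c3; simp at c3
  obtain ⟨t, ht0, ht1, htg⟩ := P.exists_gen (lt_min l1 l3)
  have ht2 := ht1.trans_le (min_le_left _ _)
  have ht3 := ht1.trans_le (min_le_right _ _)
  have act0 : P.act e0 t := ⟨by rw [a0]; exact ht0, by rw [b0]; exact ht2⟩
  have act3 : P.act e3 t := ⟨by rw [b3]; exact ht0, by rw [a3]; exact ht3⟩
  have hlt : P.h e0 t < P.h e3 t := by
    rcases lt_trichotomy (P.h e0 t) (P.h e3 t) with h | h | h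
    · exact h
    · exact absurd (P.act_inj act0 act3 h) ne
    · exfalso
      have hs := P.sum_un hφ htg ((P.h e0 t + P.h e3 t) / 2)
      rw [Finset.sum_eq_single e3] at hs
      · have := P.ind_nonneg φ (P.cell t ((P.h e0 t + P.h e3 t) / 2))
        rw [c3] at hs; omega
      · intro e he hne
        rw [mem_un] at he
        by_contra hw
        rcases hall e hw with rfl | rfl | rfl | rfl
        · linarith [he.2]
        · have := he.1.1; rw [a1] at this; linarith
        · have := he.1.1; rw [b2] at this; linarith
        · exact hne rfl
      · intro hn
        exact absurd (P.mem_un.2 ⟨act3, by linarith⟩) hn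
  refine ⟨⟨e0, e1, e2, e3, by rw [a0, b3], by rw [b0, a1], by rw [b1, a2], by rw [a3, b2], by rw [a0, b1, b0, a3, hx], by rw [a0, b1, b0, a3, hy], ?_⟩, c0, c1, c2, c3, hall⟩
  rw [a0, b0, a3]
  unfold h at hlt
  rw [a0, b0, a3, b3] at hlt
  have p1 : 0 < P.x v1 - P.x v0 := by linarith
  have p3 : 0 < P.x v3 - P.x v0 := by linarith
  have pt : 0 < t - P.x v0 := by linarith
  have h4 : (P.y v1 - P.y v0) / (P.x v1 - P.x v0) < (P.y v3 - P.y v0) / (P.x v3 - P.x v0) := by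
    refine lt_of_mul_lt_mul_left ?_ pt.le
    linarith
  rw [div_lt_div_iff₀ p1 p3] at h4
  linarith

lemma rh_of (tri : ∀ u v z, P.adj u v → P.adj v z → P.adj z u → False)
    (par : ∀ a b c d, P.adj a b → P.adj b c → P.adj c d → P.adj d a → a ≠ c → b ≠ d →
      P.x a + P.x c = P.x b + P.x d ∧ P.y a + P.y c = P.y b + P.y d)
    {φ : P.Face} (hφ : φ ≠ P.out) (hd : P.d φ = 4) : ∃ r : P.Rh, P.bdry φ r := by
  obtain ⟨e0, e1, e2, e3, v0, v1, v2, v3, h0, h1, h2, h3, n02, n13, hall⟩ := (P.four_le tri hφ).2 hd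
  obtain ⟨hx, hy⟩ := par v0 v1 v2 v3 (P.dart_adj h0) (P.dart_adj h1) (P.dart_adj h2)
    (P.dart_adj h3) n02 n13
  have m0 : P.x v0 ≠ P.x v1 := fun h => P.dart_ne h0 (P.xinj h)
  have m1 : P.x v1 ≠ P.x v2 := fun h => P.dart_ne h1 (P.xinj h)
  have m2 : P.x v2 ≠ P.x v3 := fun h => P.dart_ne h2 (P.xinj h)
  have m3 : P.x v3 ≠ P.x v0 := fun h => P.dart_ne h3 (P.xinj h)
  by_cases c1 : P.x v0 < P.x v1
  · by_cases c3 : P.x v0 < P.x v3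
    · exact P.rh_core hφ h0 h1 h2 h3 c1 c3 hx hy hall
    · have c3' := lt_of_le_of_ne (not_lt.1 c3) m3
      exact P.rh_core hφ h3 h0 h1 h2 c3' (by linarith) (by linarith) (by linarith)
        (fun e he => by have := hall e he; tauto)
  · have c1' := lt_of_le_of_ne (not_lt.1 c1) m0.symm
    by_cases c2 : P.x v1 < P.x v2
    · exact P.rh_core hφ h1 h2 h3 h0 c2 c1' (by linarith) (by linarith)
        (fun e he => by have := hall e he; tauto)
    · have c2' := lt_of_le_of_ne (not_lt.1 c2) m1.symm
      exact P.rh_core hφ h2 h3 h0 h1 (by linarith) c2' (by linarith) (by linarith)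
        (fun e he => by have := hall e he; tauto)

lemma cell_ins {φ : P.Face} (hφ : φ ≠ P.out) {r : P.Rh} (hr : P.bdry φ r) {t Y : ℝ}
    (ht : P.gen t) (h : r.ins t Y) : P.cell t Y = φ := by
  obtain ⟨k1, k2, k3, k4, k5, k6⟩ := r.h_vals h
  obtain ⟨c1, c2, c3, c4, hall⟩ := hr
  have key : ∑ e ∈ P.un t Y, P.w φ e = 1 := by
    rcases lt_or_gt_of_ne (ht (P.R r.e1)) with h1 | h1
    · rw [Finset.sum_eq_single r.e2]
      · exact c2
      · intro e he hne
        rw [mem_un] at he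
        by_contra hw
        rcases hall e hw with rfl | rfl | rfl | rfl
        · linarith [he.1.2]
        · exact hne rfl
        · linarith [he.2]
        · linarith [he.2]
      · intro hn
        refine absurd (P.mem_un.2 ⟨⟨?_, k2⟩, k4⟩) hn
        rw [← r.hb]; exact h1
    · rw [Finset.sum_eq_single r.e1]
      · exact c1
      · intro e he hne
        rw [mem_un] at he
        by_contra hw
        rcases hall e hw with rfl | rfl | rfl | rfl
        · exact hne rfl
        · have := he.1.1; rw [← r.hb] at this; linarith
        · linarith [he.2]
        · linarith [he.2]
      · intro hn
        exact absurd (P.mem_un.2 ⟨⟨k1, h1⟩, k3⟩) hn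
  rw [P.sum_un hφ ht] at key
  unfold ind at key
  split_ifs at key with h5
  · exact h5
  · simp at key

lemma ins_disj {φ ψ : P.Face} (hφ : φ ≠ P.out) (hψ : ψ ≠ P.out) {r q : P.Rh} (hr : P.bdry φ r)
    (hq : P.bdry ψ q) {t Y : ℝ} (h1 : r.ins t Y) (h2 : q.ins t Y) : φ = ψ := by
  have h3 := (r.ins_open h1).and (q.ins_open h2)
  rw [Metric.eventually_nhds_iff] at h3
  obtain ⟨ε, hε, h⟩ := h3
  obtain ⟨t', ht1, ht2, hg⟩ := P.exists_gen (show t < t + ε by linarith)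
  have := h (y := t') (by rw [Real.dist_eq, abs_of_pos] <;> linarith)
  rw [← P.cell_ins hφ hr hg this.1, ← P.cell_ins hψ hq hg this.2]

lemma d_out [Nonempty E] : 1 ≤ P.d P.out := by
  obtain ⟨e0⟩ := ‹Nonempty E›
  obtain ⟨e, he, hmin⟩ := Finset.exists_min_image (P.active (P.tg e0)) (fun e => P.h e (P.tg e0))
    ⟨e0, P.mem_active.2 (P.tg_act e0)⟩
  have : P.low e = P.out := by
    rw [P.low_eq (P.tg_gen e0) (P.mem_active.1 he)]
    have : P.bel (P.tg e0) (some e) = ∅ := by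
      ext f
      simp only [mem_bel, Finset.notMem_empty, iff_false]
      rintro ⟨h1, h2⟩
      have h3 := h2 e rfl
      have h4 := hmin f (P.mem_active.2 h1)
      linarith
    rw [pr, this, topm_empty]; rfl
  unfold d
  have h2 : 0 < (Finset.univ.filter (fun e => P.low e = P.out)).card :=
    Finset.card_pos.2 ⟨e, by simp [this]⟩
  omega

theorem exists_rh [Nonempty E] (tri : ∀ u v z, P.adj u v → P.adj v z → P.adj z u → False)
    (par : ∀ a b c d, P.adj a b → P.adj b c → P.adj c d → P.adj d a → a ≠ c → b ≠ d →
      P.x a + P.x c = P.x b + P.x d ∧ P.y a + P.y c = P.y b + P.y d) :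
    ∃ (I : Type) (_ : Fintype I) (ρ : I → P.Rh),
      3 * Fintype.card E + 1 ≤ 5 * Fintype.card V + Fintype.card I ∧
      (∀ i j, (ρ i).e1 = (ρ j).e1 → i = j) ∧ (∀ i j, (ρ i).e2 = (ρ j).e2 → i = j) ∧
      (∀ i j, (ρ i).e1 ≠ (ρ j).e2) ∧
      (∀ i j, (ρ i).f1 = (ρ j).f1 → i = j) ∧ (∀ i j, (ρ i).f2 = (ρ j).f2 → i = j) ∧
      (∀ i j, (ρ i).f1 ≠ (ρ j).f2) ∧
      (∀ i j t Y, (ρ i).ins t Y → (ρ j).ins t Y → i = j) := by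
  have : Finite P.Face := Quot.finite _
  have : Fintype P.Face := Fintype.ofFinite _
  let I := {φ : P.Face // φ ≠ P.out ∧ P.d φ = 4}
  choose ρ hρ using fun i : I => P.rh_of tri par i.2.1 i.2.2
  have up1 : ∀ i, P.up (ρ i).e1 = i.1 := fun i => P.w_one (hρ i).1
  have up2 : ∀ i, P.up (ρ i).e2 = i.1 := fun i => P.w_one (hρ i).2.1
  have lo1 : ∀ i, P.low (ρ i).f1 = i.1 := fun i => P.w_neg (hρ i).2.2.1
  have lo2 : ∀ i, P.low (ρ i).f2 = i.1 := fun i => P.w_neg (hρ i).2.2.2.1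
  refine ⟨I, inferInstance, ρ, ?_, ?_, ?_, ?_, ?_, ?_, ?_, ?_⟩
  · have hF := P.card_face
    rw [Nat.card_eq_fintype_card] at hF
    have hsum : ∑ φ, P.d φ = 2 * Fintype.card E := by
      unfold d
      rw [Finset.sum_add_distrib]
      have e1 := Finset.card_eq_sum_card_fiberwise (s := (Finset.univ : Finset E)) (f := P.up)
        (t := Finset.univ) (by simp)
      have e2 := Finset.card_eq_sum_card_fiberwise (s := (Finset.univ : Finset E)) (f := P.low)
        (t := Finset.univ) (by simp)
      rw [← e1, ← e2, Finset.card_univ]; ring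
    have hlow : ∑ φ : P.Face, (if φ = P.out then 1 else if P.d φ = 4 then 4 else 5) ≤ ∑ φ, P.d φ := by
      refine Finset.sum_le_sum fun φ _ => ?_
      split_ifs with h1 h2
      · rw [h1]; exact P.d_out
      · omega
      · have := (P.four_le tri h1).1; omega
    have heq : ∑ φ : P.Face, (if φ = P.out then 1 else if P.d φ = 4 then 4 else 5) +
        (4 + Fintype.card I) = 5 * Fintype.card P.Face := by
      have c1 : Fintype.card I = ∑ φ : P.Face, (if φ ≠ P.out ∧ P.d φ = 4 then 1 else 0) := by
        rw [Fintype.card_subtype, Finset.card_filter]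
      have c2 : 4 = ∑ φ : P.Face, (if φ = P.out then 4 else 0) := by simp
      have c3 : 4 + Fintype.card I = (∑ φ : P.Face, (if φ = P.out then 4 else 0)) +
          ∑ φ : P.Face, (if φ ≠ P.out ∧ P.d φ = 4 then 1 else 0) := by
        rw [← c1, ← c2]
      rw [c3, ← Finset.sum_add_distrib, ← Finset.sum_add_distrib, ← Finset.card_univ, mul_comm,
        ← smul_eq_mul, ← Finset.sum_const]
      refine Finset.sum_congr rfl fun φ _ => ?_
      by_cases h1 : φ = P.out <;> by_cases h2 : P.d φ = 4 <;> simp [h1, h2]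
    omega
  · intro i j h; exact Subtype.ext (by rw [← up1, h, up1])
  · intro i j h; exact Subtype.ext (by rw [← up2, h, up2])
  · intro i j h
    have : i = j := Subtype.ext (by rw [← up1, h, up2])
    subst this
    exact (ρ i).e1_ne_e2 h
  · intro i j h; exact Subtype.ext (by rw [← lo1, h, lo1])
  · intro i j h; exact Subtype.ext (by rw [← lo2, h, lo2])
  · intro i j h
    have : i = j := Subtype.ext (by rw [← lo1, h, lo2])
    subst this
    exact (ρ i).f1_ne_f2 h
  · intro i j t Y h1 h2
    exact Subtype.ext (P.ins_disj i.2.1 j.2.1 (hρ i) (hρ j) h1 h2)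

end PG

set_option linter.unusedSectionVars false

lemma mono_of_step (p : ℕ → ℝ) {M : ℕ} (hp : ∀ l < M, p l ≤ p (l + 1)) {k l : ℕ} (hkl : k ≤ l) (hl : l ≤ M) :
    p k ≤ p l := by
  induction l, hkl using Nat.le_induction with
  | base => exact le_rfl
  | succ n hn ih => exact (ih (by omega)).trans (hp n (by omega))

lemma flip_step (p : ℕ → Prop) {k M : ℕ} (hkM : k ≤ M) (hk : p k) (hM : ¬ p M) :
    ∃ l, k ≤ l ∧ l < M ∧ p l ∧ ¬ p (l + 1) := by
  by_contra hcon
  push Not at hcon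
  apply hM
  induction M, hkM using Nat.le_induction with
  | base => exact hk
  | succ n hn ih =>
    by_cases h : p n
    · exact hcon n hn (by omega) h
    · exact absurd (ih h (fun l h1 h2 => hcon l h1 (by omega))) h

/-- piecewise linear interpolation with constant extension -/
lemma interp (p q : ℕ → ℝ) (M : ℕ) (hp : ∀ l < M, p l < p (l + 1)) :
    ∃ b : ℝ → ℝ, Continuous b ∧ (∀ y ≤ p 0, b y = q 0) ∧ (∀ y, p M ≤ y → b y = q M) ∧
      ∀ l < M, ∀ y, p l ≤ y → y ≤ p (l + 1) →
        b y = q l + (y - p l) / (p (l + 1) - p l) * (q (l + 1) - q l) := by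
  induction M with
  | zero => exact ⟨fun _ => q 0, continuous_const, by simp, by simp, by simp⟩
  | succ M ih =>
    obtain ⟨b, hc, h0, hM, hl⟩ := ih (fun l hl => hp l (by omega))
    have hlt := hp M (by omega)
    have hmono : ∀ l, l ≤ M → p l ≤ p M := fun l hl => mono_of_step p (fun k hk => (hp k (by omega)).le) hl le_rfl
    refine ⟨fun y => b y + (max (p M) (min y (p (M + 1))) - p M) / (p (M + 1) - p M) *
      (q (M + 1) - q M), by fun_prop, ?_, ?_, ?_⟩
    · intro y hy
      have : y ≤ p M := hy.trans (hmono 0 (by omega))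
      simp only
      rw [min_eq_left (by linarith), max_eq_left this, h0 y hy]; simp
    · intro y hy
      simp only
      rw [min_eq_right hy, max_eq_right hlt.le, hM y (by linarith), div_self (by linarith)]; ring
    · intro l hl' y h1 h2
      simp only
      rcases Nat.lt_succ_iff_lt_or_eq.1 hl' with h3 | rfl
      · have := hmono (l + 1) (by omega)
        rw [min_eq_left (by linarith), max_eq_left (by linarith), hl l h3 y h1 h2]; simp
      · rw [min_eq_left h2, max_eq_right h1, hM y h1]

namespace PG
open scoped Classical
variable {V E : Type} (P : PG V E)

noncomputable def dx (e : E) : ℝ := P.x (P.R e) - P.x (P.L e)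
noncomputable def dy (e : E) : ℝ := P.y (P.R e) - P.y (P.L e)
noncomputable def mx (e : E) : ℝ := (P.x (P.R e) + P.x (P.L e)) / 2
noncomputable def my (e : E) : ℝ := (P.y (P.R e) + P.y (P.L e)) / 2

/-- the rhombus `r` lies above `e` and below `f` in a strip -/
def Rh.stp {P : PG V E} (r : P.Rh) (e f : E) : Prop := (e = r.e1 ∧ f = r.f1) ∨ (e = r.e2 ∧ f = r.f2)

lemma Rh.coords {P : PG V E} (r : P.Rh) :
    P.dx r.f1 = P.dx r.e1 ∧ P.dy r.f1 = P.dy r.e1 ∧ P.dx r.f2 = P.dx r.e2 ∧ P.dy r.f2 = P.dy r.e2 ∧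
    P.mx r.f1 = P.mx r.e1 + P.dx r.e2 ∧ P.my r.f1 = P.my r.e1 + P.dy r.e2 ∧
    P.mx r.f2 = P.mx r.e2 - P.dx r.e1 ∧ P.my r.f2 = P.my r.e2 - P.dy r.e1 ∧
    P.mx r.e2 = P.mx r.e1 + P.dx r.e1 / 2 + P.dx r.e2 / 2 ∧
    P.my r.e2 = P.my r.e1 + P.dy r.e1 / 2 + P.dy r.e2 / 2 ∧
    0 < P.dx r.e1 * P.dy r.e2 - P.dy r.e1 * P.dx r.e2 := by
  have hx := r.hx
  have hy := r.hy
  have hc := r.hcr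
  simp only [dx, dy, mx, my]
  rw [← r.hb, ← r.hc, ← r.hd, ← r.ha]
  refine ⟨by linarith, by linarith, by linarith, by linarith, by linarith, by linarith,
    by linarith, by linarith, by linarith, by linarith, ?_⟩
  have e1 : P.x (P.R r.f2) - P.x (P.L r.e1) = P.x (P.R r.e2) - P.x (P.R r.e1) := by linarith
  have e2 : P.y (P.R r.f2) - P.y (P.L r.e1) = P.y (P.R r.e2) - P.y (P.R r.e1) := by linarith
  rw [e1, e2] at hc
  exact hc

lemma Rh.stp_facts {P : PG V E} {r : P.Rh} {e f : E} (h : r.stp e f) :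
    P.dx f = P.dx e ∧ P.dy f = P.dy e ∧
    0 < P.dx e * (P.my f - P.my e) - P.dy e * (P.mx f - P.mx e) := by
  obtain ⟨a1, a2, a3, a4, a5, a6, a7, a8, -, -, a9⟩ := r.coords
  rcases h with ⟨rfl, rfl⟩ | ⟨rfl, rfl⟩
  · refine ⟨a1, a2, ?_⟩
    rw [a5, a6]; linarith
  · refine ⟨a3, a4, ?_⟩
    rw [a7, a8]; linarith

lemma Rh.stp_ins {P : PG V E} {r : P.Rh} {e f : E} (h : r.stp e f) {s : ℝ} (h0 : 0 < s) (h1 : s < 1) :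
    r.ins (P.mx e + s * (P.mx f - P.mx e)) (P.my e + s * (P.my f - P.my e)) := by
  have hx := r.hx
  have hy := r.hy
  rcases h with ⟨rfl, rfl⟩ | ⟨rfl, rfl⟩
  · refine ⟨1 / 2, s, by norm_num, by norm_num, h0, h1, ?_, ?_⟩
    · simp only [mx]
      rw [← r.hc, ← r.hd]
      linear_combination s / 2 * hx
    · simp only [my]
      rw [← r.hc, ← r.hd]
      linear_combination s / 2 * hy
  · refine ⟨1 - s, 1 / 2, by linarith, by linarith, by norm_num, by norm_num, ?_, ?_⟩
    · simp only [mx]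
      rw [← r.hb, ← r.ha]
      linear_combination (1 - s) / 2 * hx
    · simp only [my]
      rw [← r.hb, ← r.ha]
      linear_combination (1 - s) / 2 * hy

lemma Rh.ins_open2 {P : PG V E} (r : P.Rh) {t Y : ℝ} (h : r.ins t Y) (p q : ℝ) :
    ∀ᶠ ε in nhds (0 : ℝ), r.ins (t + ε * p) (Y + ε * q) := by
  obtain ⟨a, b, ha, ha1, hb, hb1, ht, hY⟩ := h
  have hcr := r.hcr
  set u1 := P.x (P.R r.e1) - P.x (P.L r.e1)
  set u2 := P.y (P.R r.e1) - P.y (P.L r.e1)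
  set v1 := P.x (P.R r.f2) - P.x (P.L r.e1)
  set v2 := P.y (P.R r.f2) - P.y (P.L r.e1)
  set κ := u1 * v2 - u2 * v1 with hκ
  have cA : Continuous (fun ε : ℝ => a + ε * ((p * v2 - q * v1) / κ)) := by fun_prop
  have cB : Continuous (fun ε : ℝ => b + ε * ((u1 * q - u2 * p) / κ)) := by fun_prop
  have e1 := (cA.tendsto 0).eventually (eventually_gt_nhds (b := 0) (by simpa using ha))
  have e2 := (cA.tendsto 0).eventually (eventually_lt_nhds (b := 1) (by simpa using ha1))
  have e3 := (cB.tendsto 0).eventually (eventually_gt_nhds (b := 0) (by simpa using hb))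
  have e4 := (cB.tendsto 0).eventually (eventually_lt_nhds (b := 1) (by simpa using hb1))
  filter_upwards [e1, e2, e3, e4] with ε h1 h2 h3 h4
  refine ⟨_, _, h1, h2, h3, h4, ?_, ?_⟩
  · change t + ε * p = P.x (P.L r.e1) + _ * u1 + _ * v1
    have : (p * v2 - q * v1) / κ * u1 + (u1 * q - u2 * p) / κ * v1 = p := by
      field_simp; rw [hκ]; ring
    linear_combination ht - ε * this
  · change Y + ε * q = P.y (P.L r.e1) + _ * u2 + _ * v2
    have : (p * v2 - q * v1) / κ * u2 + (u1 * q - u2 * p) / κ * v2 = q := by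
      field_simp; rw [hκ]; ring
    linear_combination hY - ε * this

lemma mid_ne {e f : E} (hc : P.dx e * P.dy f - P.dy e * P.dx f ≠ 0) (hx : P.mx e = P.mx f)
    (hy : P.my e = P.my f) : False := by
  have l1 := P.lt e
  have l2 := P.lt f
  have h1 : ∀ e, P.h e (P.mx e) = P.my e := by
    intro e
    have := P.h_aff e (P.x (P.L e)) (P.x (P.R e)) (1 / 2)
    rw [h_L, h_R] at this
    have h3 : P.mx e = (1 - 1 / 2) * P.x (P.L e) + 1 / 2 * P.x (P.R e) := by simp only [mx]; ring
    rw [h3, this]; simp only [my]; ring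
  have h2 : ∀ e, P.act e (P.mx e) := by
    intro e
    have := P.lt e
    simp only [mx]
    constructor <;> linarith
  have := P.act_inj (h2 e) (by rw [hx]; exact h2 f) (by rw [h1 e, hx, h1 f, hy])
  subst this
  apply hc; ring

variable {I : Type} (ρ : I → P.Rh)

lemma meet_aux (hdis : ∀ i j t Y, (ρ i).ins t Y → (ρ j).ins t Y → i = j) {i j : I} {e f e' f' : E}
    (h1 : (ρ i).stp e f) (h2 : (ρ j).stp e' f')
    {s r : ℝ} (s0 : 0 < s) (s1 : s < 1) (r0 : 0 ≤ r) (r1 : r ≤ 1)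
    (hx : P.mx e + s * (P.mx f - P.mx e) = P.mx e' + r * (P.mx f' - P.mx e'))
    (hy : P.my e + s * (P.my f - P.my e) = P.my e' + r * (P.my f' - P.my e')) : i = j := by
  have hi := (ρ i).ins_open2 (Rh.stp_ins h1 s0 s1) ((1 / 2 - r) * (P.mx f' - P.mx e'))
    ((1 / 2 - r) * (P.my f' - P.my e'))
  rw [Metric.eventually_nhds_iff] at hi
  obtain ⟨ε, hε, h⟩ := hi
  have hm : 0 < min (ε / 2) (1 / 2) := by positivity
  set δ := min (ε / 2) (1 / 2)
  have d1 : δ ≤ ε / 2 := min_le_left _ _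
  have d2 : δ ≤ 1 / 2 := min_le_right _ _
  have h3 := h (y := δ) (by rw [Real.dist_eq, sub_zero, abs_of_pos hm]; linarith)
  have h4 := Rh.stp_ins h2 (s := r + δ * (1 / 2 - r)) (by nlinarith) (by nlinarith)
  rw [hx, hy] at h3
  refine hdis i j _ _ h3 ?_
  convert h4 using 1 <;> ring

lemma meet (hdis : ∀ i j t Y, (ρ i).ins t Y → (ρ j).ins t Y → i = j) {i j : I} {e f e' f' : E}
    (h1 : (ρ i).stp e f) (h2 : (ρ j).stp e' f') (hc : P.dx e * P.dy e' - P.dy e * P.dx e' ≠ 0)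
    {s r : ℝ} (s0 : 0 ≤ s) (s1 : s ≤ 1) (r0 : 0 ≤ r) (r1 : r ≤ 1)
    (hx : P.mx e + s * (P.mx f - P.mx e) = P.mx e' + r * (P.mx f' - P.mx e'))
    (hy : P.my e + s * (P.my f - P.my e) = P.my e' + r * (P.my f' - P.my e')) : i = j := by
  obtain ⟨f1, f2, -⟩ := Rh.stp_facts h1
  obtain ⟨f3, f4, -⟩ := Rh.stp_facts h2
  rcases s0.eq_or_lt with rfl | s0
  · rcases r0.eq_or_lt with rfl | r0
    · exact (P.mid_ne (e := e) (f := e') hc (by linarith) (by linarith)).elim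
    · rcases r1.eq_or_lt with rfl | r1
      · exact (P.mid_ne (e := e) (f := f') (by rwa [f3, f4]) (by linarith) (by linarith)).elim
      · exact (P.meet_aux ρ hdis h2 h1 r0 r1 le_rfl s1 hx.symm hy.symm).symm
  · rcases s1.eq_or_lt with rfl | s1
    · rcases r0.eq_or_lt with rfl | r0
      · exact (P.mid_ne (e := f) (f := e') (by rwa [f1, f2]) (by linarith) (by linarith)).elim
      · rcases r1.eq_or_lt with rfl | r1
        · exact (P.mid_ne (e := f) (f := f') (by rwa [f1, f2, f3, f4]) (by linarith) (by linarith)).elim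
        · exact (P.meet_aux ρ hdis h2 h1 r0 r1 s0.le le_rfl hx.symm hy.symm).symm
    · exact P.meet_aux ρ hdis h1 h2 s0 s1 r0 r1 hx hy

/-- being the next edge in a strip -/
def nx (e f : E) : Prop := ∃ i, (ρ i).stp e f

lemma nx_chain {e f : E} (h : Relation.ReflTransGen (P.nx ρ) e f) :
    ∃ (K : ℕ) (g : ℕ → E), g 0 = e ∧ g K = f ∧ ∀ k < K, P.nx ρ (g k) (g (k + 1)) := by
  induction h with
  | refl => exact ⟨0, fun _ => e, rfl, rfl, by simp⟩
  | @tail b c _ hbc ih =>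
    obtain ⟨K, g, h0, hK, hs⟩ := ih
    refine ⟨K + 1, fun k => if k ≤ K then g k else c, by simp [h0], by simp, ?_⟩
    intro k hk
    by_cases hkK : k = K
    · subst hkK; simpa [hK] using hbc
    · have a1 : k ≤ K := by omega
      have a2 : k + 1 ≤ K := by omega
      simpa [a1, a2] using hs k (by omega)

lemma chain_nx {g : ℕ → E} {k l : ℕ} (hkl : k ≤ l) (h : ∀ m < l, P.nx ρ (g m) (g (m + 1))) :
    Relation.ReflTransGen (P.nx ρ) (g k) (g l) := by
  induction l, hkl using Nat.le_induction with
  | base => exact .refl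
  | succ n hn ih => exact (ih (fun m hm => h m (by omega))).tail (h n (by omega))

lemma chain_dir {g : ℕ → E} {l : ℕ} (h : ∀ m < l, P.nx ρ (g m) (g (m + 1))) :
    P.dx (g l) = P.dx (g 0) ∧ P.dy (g l) = P.dy (g 0) := by
  induction l with
  | zero => exact ⟨rfl, rfl⟩
  | succ n ih =>
    obtain ⟨a, b⟩ := ih (fun m hm => h m (by omega))
    obtain ⟨i, hi⟩ := h n (by omega)
    obtain ⟨c, d, -⟩ := Rh.stp_facts hi
    exact ⟨c.trans a, d.trans b⟩

lemma nx_e1 (i1 : ∀ i j, (ρ i).e1 = (ρ j).e1 → i = j) (i12 : ∀ i j, (ρ i).e1 ≠ (ρ j).e2) {i : I} {f : E}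
    (h : P.nx ρ (ρ i).e1 f) : f = (ρ i).f1 := by
  obtain ⟨j, ⟨h1, h2⟩ | ⟨h1, h2⟩⟩ := h
  · rw [h2, i1 _ _ h1]
  · exact absurd h1 (i12 _ _)

lemma nx_e2 (i2 : ∀ i j, (ρ i).e2 = (ρ j).e2 → i = j) (i12 : ∀ i j, (ρ i).e1 ≠ (ρ j).e2) {i : I} {f : E}
    (h : P.nx ρ (ρ i).e2 f) : f = (ρ i).f2 := by
  obtain ⟨j, ⟨h1, h2⟩ | ⟨h1, h2⟩⟩ := h
  · exact absurd h1.symm (i12 _ _)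
  · rw [h2, i2 _ _ h1]

/-- a chain through both `e2 i` and `e2 j` -/
lemma two_chain (i2 : ∀ i j, (ρ i).e2 = (ρ j).e2 → i = j) (i12 : ∀ i j, (ρ i).e1 ≠ (ρ j).e2) {i j : I}
    (h : Relation.ReflTransGen (P.nx ρ) (ρ i).e2 (ρ j).e2 ∨
      Relation.ReflTransGen (P.nx ρ) (ρ j).e2 (ρ i).e2) :
    ∃ (M : ℕ) (g : ℕ → E) (a b : ℕ), a ≤ M ∧ b ≤ M ∧ g a = (ρ i).e2 ∧ g b = (ρ j).e2 ∧
      g (a + 1) = (ρ i).f2 ∧ g (b + 1) = (ρ j).f2 ∧ (∀ k < M + 1, P.nx ρ (g k) (g (k + 1))) ∧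
      (a = 0 ∧ b = M ∨ b = 0 ∧ a = M) := by
  rcases h with h | h
  · have h' := h.tail (⟨j, Or.inr ⟨rfl, rfl⟩⟩ : P.nx ρ (ρ j).e2 (ρ j).f2)
    obtain ⟨M, g, h0, hM, hs⟩ := P.nx_chain ρ h
    let g' : ℕ → E := fun k => if k ≤ M then g k else (ρ j).f2
    have hs' : ∀ k < M + 1, P.nx ρ (g' k) (g' (k + 1)) := by
      intro k hk
      by_cases hkK : k = M
      · subst hkK; simp only [g', le_refl, if_true, hM]; simpa using ⟨j, Or.inr ⟨rfl, rfl⟩⟩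
      · have a1 : k ≤ M := by omega
        have a2 : k + 1 ≤ M := by omega
        simpa [g', a1, a2] using hs k (by omega)
    have g0 : g' 0 = (ρ i).e2 := by simp [g', h0]
    have gM : g' M = (ρ j).e2 := by simp [g', hM]
    refine ⟨M, g', 0, M, by omega, le_rfl, g0, gM, ?_, by simp [g'], hs', Or.inl ⟨rfl, rfl⟩⟩
    exact P.nx_e2 ρ i2 i12 (by rw [← g0]; exact hs' 0 (by omega))
  · have h' := h.tail (⟨i, Or.inr ⟨rfl, rfl⟩⟩ : P.nx ρ (ρ i).e2 (ρ i).f2)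
    obtain ⟨M, g, h0, hM, hs⟩ := P.nx_chain ρ h
    let g' : ℕ → E := fun k => if k ≤ M then g k else (ρ i).f2
    have hs' : ∀ k < M + 1, P.nx ρ (g' k) (g' (k + 1)) := by
      intro k hk
      by_cases hkK : k = M
      · subst hkK; simp only [g', le_refl, if_true, hM]; simpa using ⟨i, Or.inr ⟨rfl, rfl⟩⟩
      · have a1 : k ≤ M := by omega
        have a2 : k + 1 ≤ M := by omega
        simpa [g', a1, a2] using hs k (by omega)
    have g0 : g' 0 = (ρ j).e2 := by simp [g', h0]
    have gM : g' M = (ρ i).e2 := by simp [g', hM]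
    refine ⟨M, g', M, 0, le_rfl, by omega, gM, g0, by simp [g'], ?_, hs', Or.inr ⟨rfl, rfl⟩⟩
    exact P.nx_e2 ρ i2 i12 (by rw [← g0]; exact hs' 0 (by omega))

set_option maxHeartbeats 1000000 in
lemma twice (hdis : ∀ i j t Y, (ρ i).ins t Y → (ρ j).ins t Y → i = j)
    (i1 : ∀ i j, (ρ i).e1 = (ρ j).e1 → i = j) (i2 : ∀ i j, (ρ i).e2 = (ρ j).e2 → i = j)
    (i12 : ∀ i j, (ρ i).e1 ≠ (ρ j).e2) (K : ℕ) : ∀ (i j : I) (g : ℕ → E), 1 ≤ K → g 0 = (ρ i).e1 →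
    g K = (ρ j).e1 → (∀ k < K, P.nx ρ (g k) (g (k + 1))) →
    (Relation.ReflTransGen (P.nx ρ) (ρ i).e2 (ρ j).e2 ∨
      Relation.ReflTransGen (P.nx ρ) (ρ j).e2 (ρ i).e2) → False := by
  induction K using Nat.strong_induction_on with
  | _ K ih =>
  intro i j g hK1 g0 gK hg hB
  obtain ⟨M, g', a, b, haM, hbM, ga, gb, ga1, gb1, hg', hab⟩ := P.two_chain ρ i2 i12 hB
  have g1 : g 1 = (ρ i).f1 := P.nx_e1 ρ i1 i12 (by rw [← g0]; exact hg 0 (by omega))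
  obtain ⟨u1, hu1⟩ : ∃ u, u = P.dx (ρ i).e1 := ⟨_, rfl⟩
  obtain ⟨u2, hu2⟩ : ∃ u, u = P.dy (ρ i).e1 := ⟨_, rfl⟩
  obtain ⟨v1, hv1⟩ : ∃ u, u = P.dx (ρ i).e2 := ⟨_, rfl⟩
  obtain ⟨v2, hv2⟩ : ∃ u, u = P.dy (ρ i).e2 := ⟨_, rfl⟩
  have dg : ∀ k ≤ K, P.dx (g k) = u1 ∧ P.dy (g k) = u2 := by
    intro k hk
    have := P.chain_dir ρ (g := g) (l := k) (fun m hm => hg m (by omega))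
    rw [g0] at this
    rwa [hu1, hu2]
  have dg' : ∀ k ≤ M + 1, P.dx (g' k) = v1 ∧ P.dy (g' k) = v2 := by
    intro k hk
    have t1 := P.chain_dir ρ (g := g') (l := k) (fun m hm => hg' m (by omega))
    have t2 := P.chain_dir ρ (g := g') (l := a) (fun m hm => hg' m (by omega))
    rw [ga] at t2
    rw [hv1, hv2, t2.1, t2.2]
    exact t1
  have dj1 := dg K le_rfl
  have dj2 := dg' b (by omega)
  rw [gK] at dj1
  rw [gb] at dj2
  obtain ⟨-, -, -, -, c5, c6, c7, c8, c9, c10, c11⟩ := (ρ i).coords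
  obtain ⟨-, -, -, -, k5, k6, k7, k8, k9, k10, -⟩ := (ρ j).coords
  rw [← hv1] at c5
  rw [← hv2] at c6
  rw [← hu1] at c7
  rw [← hu2] at c8
  rw [← hu1, ← hv1] at c9
  rw [← hu2, ← hv2] at c10
  rw [← hu1, ← hu2, ← hv1, ← hv2] at c11
  rw [dj2.1] at k5
  rw [dj2.2] at k6
  rw [dj1.1] at k7
  rw [dj1.2] at k8
  rw [dj1.1, dj2.1] at k9
  rw [dj1.2, dj2.2] at k10
  let A : E → ℝ := fun e => u1 * P.my e - u2 * P.mx e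
  let B : E → ℝ := fun e => v1 * P.my e - v2 * P.mx e
  have A1 : A (ρ i).f1 = A (ρ i).e1 + (u1 * v2 - u2 * v1) := by
    simp only [A]; rw [c5, c6]; ring
  have A2 : A (ρ i).e2 = A (ρ i).e1 + (u1 * v2 - u2 * v1) / 2 := by
    simp only [A]; rw [c9, c10]; ring
  have A3 : A (ρ i).f2 = A (ρ i).e2 := by
    simp only [A]; rw [c7, c8]; ring
  have B1 : B (ρ i).f1 = B (ρ i).e1 := by
    simp only [B]; rw [c5, c6]; ring
  have B2 : B (ρ i).e2 = B (ρ i).e1 - (u1 * v2 - u2 * v1) / 2 := by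
    simp only [B]; rw [c9, c10]; ring
  have B3 : B (ρ i).f2 = B (ρ i).e2 + (u1 * v2 - u2 * v1) := by
    simp only [B]; rw [c7, c8]; ring
  have A2' : A (ρ j).e2 = A (ρ j).e1 + (u1 * v2 - u2 * v1) / 2 := by
    simp only [A]; rw [k9, k10]; ring
  have A3' : A (ρ j).f2 = A (ρ j).e2 := by
    simp only [A]; rw [k7, k8]; ring
  have B2' : B (ρ j).e2 = B (ρ j).e1 - (u1 * v2 - u2 * v1) / 2 := by
    simp only [B]; rw [k9, k10]; ring
  have B3' : B (ρ j).f2 = B (ρ j).e2 + (u1 * v2 - u2 * v1) := by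
    simp only [B]; rw [k7, k8]; ring
  have incA : ∀ k < K, A (g k) < A (g (k + 1)) := by
    intro k hk
    obtain ⟨c, hc⟩ := hg k hk
    have := (Rh.stp_facts hc).2.2
    rw [(dg k hk.le).1, (dg k hk.le).2] at this
    simp only [A]; linarith
  have incB : ∀ k < M + 1, B (g' k) < B (g' (k + 1)) := by
    intro k hk
    obtain ⟨c, hc⟩ := hg' k hk
    have := (Rh.stp_facts hc).2.2
    rw [(dg' k hk.le).1, (dg' k hk.le).2] at this
    simp only [B]; linarith
  obtain ⟨bf, hbc, hb0, hbM, hbl⟩ := interp (fun l => B (g' l)) (fun l => A (g' l)) (M + 1) incB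
  beta_reduce at hb0 hbM hbl
  have F1 : 0 < A (g 1) - bf (B (g 1)) := by
    have := hbl a (by omega) (B (g 1)) (by rw [ga, g1]; linarith) (by rw [ga1, g1]; linarith)
    rw [this, ga, ga1, g1, A3]; linarith
  have FK : ¬ 0 < A (g K) - bf (B (g K)) := by
    have := hbl b (by omega) (B (g K)) (by rw [gb, gK]; linarith) (by rw [gb1, gK]; linarith)
    rw [this, gb, gb1, gK, A3']; linarith
  obtain ⟨k, hk1, hkK, hFk, hFk'⟩ := flip_step (fun k => 0 < A (g k) - bf (B (g k))) hK1 F1 FK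
  beta_reduce at hFk hFk'
  have hcont : Continuous (fun s : ℝ => A (g k) + s * (A (g (k + 1)) - A (g k)) -
      bf (B (g k) + s * (B (g (k + 1)) - B (g k)))) := by fun_prop
  have hz : (0 : ℝ) ∈ (fun s : ℝ => A (g k) + s * (A (g (k + 1)) - A (g k)) -
      bf (B (g k) + s * (B (g (k + 1)) - B (g k)))) '' Set.Icc 0 1 := by
    refine intermediate_value_Icc' zero_le_one hcont.continuousOn ⟨?_, ?_⟩
    · simpa using hFk'
    · simpa using hFk.le
  obtain ⟨s, ⟨s0, s1⟩, hs⟩ := hz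
  beta_reduce at hs
  have lowA : A (g 1) ≤ A (g k) := mono_of_step (fun k => A (g k)) (fun l hl => (incA l hl).le) hk1 hkK.le
  have uppA : A (g (k + 1)) ≤ A (g K) :=
    mono_of_step (fun k => A (g k)) (fun l hl => (incA l hl).le) hkK le_rfl
  rw [g1] at lowA
  rw [gK] at uppA
  have hstep := incA k hkK
  set zA := A (g k) + s * (A (g (k + 1)) - A (g k)) with hzA
  set zB := B (g k) + s * (B (g (k + 1)) - B (g k)) with hzB
  have z0 : 0 ≤ s * (A (g (k + 1)) - A (g k)) := mul_nonneg s0 (by linarith)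
  have z0' : s * (A (g (k + 1)) - A (g k)) ≤ A (g (k + 1)) - A (g k) :=
    mul_le_of_le_one_left (by linarith) s1
  have z1 : A (ρ i).e2 < zA := by linarith
  have z2 : zA < A (ρ j).e2 := by linarith
  have q0 : A (g' 0) = A (ρ i).e2 ∨ A (g' 0) = A (ρ j).e2 := by
    rcases hab with ⟨h, -⟩ | ⟨h, -⟩
    · left; rw [← ga, h]
    · right; rw [← gb, h]
  have qM : A (g' (M + 1)) = A (ρ i).e2 ∨ A (g' (M + 1)) = A (ρ j).e2 := by
    rcases hab with ⟨-, h⟩ | ⟨-, h⟩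
    · right; rw [← h, gb1, A3']
    · left; rw [← h, ga1, A3]
  have hy0 : B (g' 0) ≤ zB := by
    by_contra hcon
    have := hb0 zB (by linarith)
    rcases q0 with h | h <;> linarith
  have hyM : ¬ B (g' (M + 1)) ≤ zB := by
    intro hcon
    have := hbM zB hcon
    rcases qM with h | h <;> linarith
  obtain ⟨l, -, hlM, hl1, hl2⟩ := flip_step (fun l => B (g' l) ≤ zB) (Nat.zero_le _) hy0 hyM
  simp only [not_le] at hl1 hl2
  have hbz := hbl l hlM zB hl1 hl2.le
  have hBl := incB l hlM
  set r := (zB - B (g' l)) / (B (g' (l + 1)) - B (g' l)) with hr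
  have r0 : 0 ≤ r := div_nonneg (by linarith) (by linarith)
  have r1 : r ≤ 1 := by rw [hr, div_le_one (by linarith)]; linarith
  have hzB' : zB = B (g' l) + r * (B (g' (l + 1)) - B (g' l)) := by
    rw [hr, div_mul_cancel₀ _ (by linarith)]; ring
  have hzA' : zA = A (g' l) + r * (A (g' (l + 1)) - A (g' l)) := by linarith
  rw [hzA] at hzA'
  rw [hzB] at hzB'
  obtain ⟨c, hc⟩ := hg k hkK
  obtain ⟨c', hc'⟩ := hg' l hlM
  have hκ : u1 * v2 - u2 * v1 ≠ 0 := by linarith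
  have hcc : c = c' := by
    refine P.meet ρ hdis hc hc' ?_ s0 s1 r0 r1 ?_ ?_
    · rw [(dg k hkK.le).1, (dg k hkK.le).2, (dg' l hlM.le).1, (dg' l hlM.le).2]
      exact hκ
    · apply mul_left_cancel₀ hκ
      simp only [A, B] at hzA' hzB'
      linear_combination v1 * hzA' - u1 * hzB'
    · apply mul_left_cancel₀ hκ
      simp only [A, B] at hzA' hzB'
      linear_combination v2 * hzA' - u2 * hzB'
  subst hcc
  have ek := dg k hkK.le
  have el := dg' l hlM.le
  have hcr := (ρ c).coords.2.2.2.2.2.2.2.2.2.2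
  rcases hc with ⟨h1, h2⟩ | ⟨h1, h2⟩ <;> rcases hc' with ⟨h3, h4⟩ | ⟨h3, h4⟩
  · rw [h1] at ek
    rw [h3] at el
    apply hκ
    rw [← ek.1, ← ek.2, ← el.1, ← el.2]; ring
  · refine ih k hkK i c g hk1 g0 h1 (fun m hm => hg m (by omega)) ?_
    rw [← ga, ← h3]
    rcases le_total a l with h | h
    · left; exact P.chain_nx ρ h (fun m hm => hg' m (by omega))
    · right; exact P.chain_nx ρ h (fun m hm => hg' m (by omega))
  · rw [h1] at ek
    rw [h3] at el
    rw [ek.1, ek.2, el.1, el.2] at hcr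
    linarith
  · rw [h1] at ek
    rw [h3] at el
    apply hκ
    rw [← ek.1, ← ek.2, ← el.1, ← el.2]; ring

end PG

set_option linter.unusedSectionVars false

namespace PG
open scoped Classical
variable {V E : Type} (P : PG V E) {I : Type} (ρ : I → P.Rh)

lemma rtg_dir {e f : E} (h : Relation.ReflTransGen (P.nx ρ) e f) : P.dx f = P.dx e ∧ P.dy f = P.dy e := by
  obtain ⟨K, g, h0, hK, hs⟩ := P.nx_chain ρ h
  have := P.chain_dir ρ hs
  rwa [h0, hK] at this

lemma exists_top [Finite E] (e : E) :
    ∃ f, Relation.ReflTransGen (P.nx ρ) e f ∧ ∀ f', ¬ P.nx ρ f f' := by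
  obtain ⟨f, hf, hmax⟩ := Set.exists_max_image {f | Relation.ReflTransGen (P.nx ρ) e f}
    (fun f => P.dx e * P.my f - P.dy e * P.mx f) (Set.toFinite _) ⟨e, .refl⟩
  refine ⟨f, hf, fun f' hn => ?_⟩
  have h1 := hmax f' (hf.tail hn)
  obtain ⟨d1, d2⟩ := P.rtg_dir ρ hf
  obtain ⟨i, hi⟩ := hn
  have h2 := (Rh.stp_facts hi).2.2
  rw [d1, d2] at h2
  linarith

lemma same_top
    (j1 : ∀ i j, (ρ i).f1 = (ρ j).f1 → i = j) (j2 : ∀ i j, (ρ i).f2 = (ρ j).f2 → i = j)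
    (j12 : ∀ i j, (ρ i).f1 ≠ (ρ j).f2) {e e' f : E} (h : Relation.ReflTransGen (P.nx ρ) e f)
    (h' : Relation.ReflTransGen (P.nx ρ) e' f) :
    Relation.ReflTransGen (P.nx ρ) e e' ∨ Relation.ReflTransGen (P.nx ρ) e' e := by
  have U : Relator.RightUnique (Function.swap (P.nx ρ)) := by
    rintro a b c ⟨i, hi⟩ ⟨j, hj⟩
    rcases hi with ⟨h1, h2⟩ | ⟨h1, h2⟩ <;> rcases hj with ⟨h3, h4⟩ | ⟨h3, h4⟩
    · rw [h1, h3, j1 i j (h2.symm.trans h4)]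
    · exact absurd (h2.symm.trans h4) (j12 _ _)
    · exact absurd (h4.symm.trans h2) (j12 _ _)
    · rw [h1, h3, j2 i j (h2.symm.trans h4)]
  have := Relation.ReflTransGen.total_of_right_unique U (Relation.reflTransGen_swap.2 h)
    (Relation.reflTransGen_swap.2 h')
  rcases this with h | h
  · right; exact Relation.reflTransGen_swap.1 h
  · left; exact Relation.reflTransGen_swap.1 h

theorem strip_count [Fintype E] [Fintype I]
    (i1 : ∀ i j, (ρ i).e1 = (ρ j).e1 → i = j) (i2 : ∀ i j, (ρ i).e2 = (ρ j).e2 → i = j)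
    (i12 : ∀ i j, (ρ i).e1 ≠ (ρ j).e2)
    (j1 : ∀ i j, (ρ i).f1 = (ρ j).f1 → i = j) (j2 : ∀ i j, (ρ i).f2 = (ρ j).f2 → i = j)
    (j12 : ∀ i j, (ρ i).f1 ≠ (ρ j).f2)
    (hdis : ∀ i j t Y, (ρ i).ins t Y → (ρ j).ins t Y → i = j) :
    ∃ s, s + 2 * Fintype.card I = Fintype.card E ∧ Fintype.card E ≤ s ^ 2 := by
  let S := {e : E // ∀ f, ¬ P.nx ρ e f}
  have hS : Fintype.card S + 2 * Fintype.card I = Fintype.card E := by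
    have : Fintype.card (S ⊕ (I ⊕ I)) = Fintype.card E := by
      refine Fintype.card_of_bijective (f := Sum.elim (fun s => s.1)
        (Sum.elim (fun i => (ρ i).e1) (fun i => (ρ i).e2))) ⟨?_, ?_⟩
      · rintro (a | a | a) (b | b | b) h
        · simp only [Sum.elim_inl] at h; rw [Subtype.ext h]
        · exact absurd ⟨b, Or.inl ⟨h, rfl⟩⟩ (a.2 (ρ b).f1)
        · exact absurd ⟨b, Or.inr ⟨h, rfl⟩⟩ (a.2 (ρ b).f2)
        · exact absurd ⟨a, Or.inl ⟨h.symm, rfl⟩⟩ (b.2 (ρ a).f1)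
        · rw [i1 a b h]
        · exact absurd h (i12 _ _)
        · exact absurd ⟨a, Or.inr ⟨h.symm, rfl⟩⟩ (b.2 (ρ a).f2)
        · exact absurd h.symm (i12 _ _)
        · rw [i2 a b h]
      · intro e
        by_cases he : ∀ f, ¬ P.nx ρ e f
        · exact ⟨Sum.inl ⟨e, he⟩, rfl⟩
        · push Not at he
          obtain ⟨f, i, ⟨h1, h2⟩ | ⟨h1, h2⟩⟩ := he
          · exact ⟨Sum.inr (Sum.inl i), h1.symm⟩
          · exact ⟨Sum.inr (Sum.inr i), h1.symm⟩
    simp only [Fintype.card_sum] at this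
    omega
  refine ⟨Fintype.card S, hS, ?_⟩
  choose tp htp htp' using P.exists_top ρ
  have dir_ne : ∀ i j, tp (ρ i).e1 = tp (ρ j).e2 → tp (ρ i).e2 = tp (ρ j).e1 → False := by
    intro i j h1 h2
    obtain ⟨a1, a2⟩ := P.rtg_dir ρ (htp (ρ i).e1)
    obtain ⟨b1, b2⟩ := P.rtg_dir ρ (htp (ρ j).e2)
    obtain ⟨c1, c2⟩ := P.rtg_dir ρ (htp (ρ i).e2)
    obtain ⟨d1, d2⟩ := P.rtg_dir ρ (htp (ρ j).e1)
    have ci := (ρ i).coords.2.2.2.2.2.2.2.2.2.2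
    have cj := (ρ j).coords.2.2.2.2.2.2.2.2.2.2
    rw [h1] at a1 a2
    rw [h2] at c1 c2
    rw [← b1, ← b2, ← d1, ← d2] at cj
    rw [← a1, ← a2, ← c1, ← c2] at ci
    linarith
  have dir_ne' : ∀ i, tp (ρ i).e1 ≠ tp (ρ i).e2 := fun i h => dir_ne i i h h.symm
  have key : ∀ i j, tp (ρ i).e1 = tp (ρ j).e1 → tp (ρ i).e2 = tp (ρ j).e2 → i = j := by
    intro i j h1 h2
    have r1 := P.same_top ρ j1 j2 j12 (htp (ρ i).e1) (e' := (ρ j).e1) (by rw [h1]; exact htp _)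
    have r2 := P.same_top ρ j1 j2 j12 (htp (ρ i).e2) (e' := (ρ j).e2) (by rw [h2]; exact htp _)
    rcases r1 with r1 | r1
    · obtain ⟨K, g, h0, hK, hs⟩ := P.nx_chain ρ r1
      rcases Nat.eq_zero_or_pos K with rfl | hpos
      · exact i1 _ _ (h0.symm.trans hK)
      · exact (P.twice ρ hdis i1 i2 i12 K i j g hpos h0 hK hs r2).elim
    · obtain ⟨K, g, h0, hK, hs⟩ := P.nx_chain ρ r1
      rcases Nat.eq_zero_or_pos K with rfl | hpos
      · exact (i1 _ _ (h0.symm.trans hK)).symm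
      · exact (P.twice ρ hdis i1 i2 i12 K j i g hpos h0 hK hs r2.symm).elim
  have hle : Fintype.card (S ⊕ (I ⊕ I)) ≤ Fintype.card (S × S) := by
    refine Fintype.card_le_of_injective (Sum.elim (fun s => (s, s))
        (Sum.elim (fun i => (⟨tp (ρ i).e1, htp' _⟩, ⟨tp (ρ i).e2, htp' _⟩))
          (fun i => (⟨tp (ρ i).e2, htp' _⟩, ⟨tp (ρ i).e1, htp' _⟩)))) ?_
    rintro (a | a | a) (b | b | b) h <;>
      simp only [Sum.elim_inl, Sum.elim_inr, Prod.mk.injEq] at h <;> obtain ⟨h1, h2⟩ := h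
    · rw [h1]
    · exact absurd (congrArg Subtype.val (h1.symm.trans h2)) (dir_ne' b)
    · exact absurd (congrArg Subtype.val (h2.symm.trans h1)) (dir_ne' b)
    · exact absurd (congrArg Subtype.val (h1.trans h2.symm)) (dir_ne' a)
    · rw [key a b (congrArg Subtype.val h1) (congrArg Subtype.val h2)]
    · exact (dir_ne a b (congrArg Subtype.val h1) (congrArg Subtype.val h2)).elim
    · exact absurd (congrArg Subtype.val (h2.trans h1.symm)) (dir_ne' a)
    · exact (dir_ne b a (congrArg Subtype.val h1).symm (congrArg Subtype.val h2).symm).elim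
    · rw [key a b (congrArg Subtype.val h2) (congrArg Subtype.val h1)]
  simp only [Fintype.card_sum, Fintype.card_prod] at hle
  rw [pow_two]
  omega

/-- the purely combinatorial upper bound -/
theorem upper [Fintype V] [Fintype E] [Nonempty E]
    (tri : ∀ u v z, P.adj u v → P.adj v z → P.adj z u → False)
    (par : ∀ a b c d, P.adj a b → P.adj b c → P.adj c d → P.adj d a → a ≠ c → b ≠ d →
      P.x a + P.x c = P.x b + P.x d ∧ P.y a + P.y c = P.y b + P.y d) :
    ∃ D : ℕ, Fintype.card E + D = 2 * Fintype.card V ∧ 2 * Fintype.card V ≤ 25 * D ^ 2 := by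
  obtain ⟨I, _, ρ, hc, i1, i2, i12, j1, j2, j12, hdis⟩ := P.exists_rh tri par
  obtain ⟨s, hs, hs2⟩ := P.strip_count ρ i1 i2 i12 j1 j2 j12 hdis
  have h1 : s + 5 * Fintype.card E + 2 ≤ 10 * Fintype.card V := by omega
  obtain ⟨D, hD⟩ := Nat.exists_eq_add_of_le (show Fintype.card E ≤ 2 * Fintype.card V by omega)
  refine ⟨D, hD.symm, ?_⟩
  have h2 : s + 2 ≤ 5 * D := by omega
  obtain ⟨k, rfl⟩ := Nat.exists_eq_add_of_le (show 1 ≤ D by omega)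
  have h3 : s ^ 2 ≤ (5 * k + 3) ^ 2 := Nat.pow_le_pow_left (by omega) 2
  nlinarith

end PG

set_option linter.unusedSectionVars false

lemma rhombus_alg {a0 a1 b0 b1 c0 c1 d0 d1 : ℝ}
    (h1 : (a0 - b0) ^ 2 + (a1 - b1) ^ 2 = 1) (h2 : (b0 - c0) ^ 2 + (b1 - c1) ^ 2 = 1)
    (h3 : (c0 - d0) ^ 2 + (c1 - d1) ^ 2 = 1) (h4 : (d0 - a0) ^ 2 + (d1 - a1) ^ 2 = 1)
    (hac : ¬ (a0 = c0 ∧ a1 = c1)) (hbd : ¬ (b0 = d0 ∧ b1 = d1)) :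
    a0 + c0 = b0 + d0 ∧ a1 + c1 = b1 + d1 := by
  have pos1 : 0 < (a0 - c0) ^ 2 + (a1 - c1) ^ 2 := by
    by_contra hcon
    apply hac
    constructor <;> nlinarith [sq_nonneg (a0 - c0), sq_nonneg (a1 - c1)]
  have pos2 : 0 < (b0 - d0) ^ 2 + (b1 - d1) ^ 2 := by
    by_contra hcon
    apply hbd
    constructor <;> nlinarith [sq_nonneg (b0 - d0), sq_nonneg (b1 - d1)]
  have perp : (b0 - d0) * (c0 - a0) + (b1 - d1) * (c1 - a1) = 0 := by
    linear_combination (h1 - h2 + h3 - h4) / 2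
  have hdet : ((b0 - d0) * (c1 - a1) - (b1 - d1) * (c0 - a0)) ^ 2 =
      ((b0 - d0) ^ 2 + (b1 - d1) ^ 2) * ((a0 - c0) ^ 2 + (a1 - c1) ^ 2) := by
    linear_combination -((b0 - d0) * (c0 - a0) + (b1 - d1) * (c1 - a1)) * perp
  have hdet0 : (b0 - d0) * (c1 - a1) - (b1 - d1) * (c0 - a0) ≠ 0 := by
    intro h0
    rw [h0] at hdet
    have := mul_pos pos2 pos1
    rw [← hdet] at this
    norm_num at this
  have k1 : (b0 - d0) * (a0 + c0 - b0 - d0) + (b1 - d1) * (a1 + c1 - b1 - d1) = 0 := by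
    linear_combination (-h1 - h2 + h3 + h4) / 2
  have k2 : (c0 - a0) * (a0 + c0 - b0 - d0) + (c1 - a1) * (a1 + c1 - b1 - d1) = 0 := by
    linear_combination (-h1 + h2 + h3 - h4) / 2
  constructor
  · have : ((b0 - d0) * (c1 - a1) - (b1 - d1) * (c0 - a0)) * (a0 + c0 - b0 - d0) = 0 := by
      linear_combination (c1 - a1) * k1 - (b1 - d1) * k2
    have := (mul_eq_zero.1 this).resolve_left hdet0
    linarith
  · have : ((b0 - d0) * (c1 - a1) - (b1 - d1) * (c0 - a0)) * (a1 + c1 - b1 - d1) = 0 := by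
      linear_combination -(c0 - a0) * k1 + (b0 - d0) * k2
    have := (mul_eq_zero.1 this).resolve_left hdet0
    linarith

lemma exists_tilt {V : Type} [Finite V] (p q : V → ℝ) (h : ∀ u v, p u = p v → q u = q v → u = v) :
    ∃ ε : ℝ, Function.Injective (fun v => p v + ε * q v) := by
  have hf : (Set.range (fun uv : V × V => -(p uv.1 - p uv.2) / (q uv.1 - q uv.2))).Finite :=
    Set.finite_range _
  obtain ⟨ε, hε⟩ := hf.exists_notMem
  refine ⟨ε, fun u v huv => ?_⟩
  by_contra hne
  simp only at huv
  by_cases hq : q u = q v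
  · exact hne (h u v (by rw [hq] at huv; linarith) hq)
  · apply hε
    refine ⟨(u, v), ?_⟩
    have : q u - q v ≠ 0 := sub_ne_zero.2 hq
    simp only
    rw [div_eq_iff this]; linarith

section conn
open scoped Classical
variable {n : ℕ} {G : SimpleGraph (Fin n)} (M : MatchstickEmbedding G)

lemma ext2 {p q : EuclideanSpace ℝ (Fin 2)} (h0 : p 0 = q 0) (h1 : p 1 = q 1) : p = q := by
  ext i; fin_cases i <;> assumption

lemma unit_sq {u v : Fin n} (h : G.Adj u v) :
    (M.pos u 0 - M.pos v 0) ^ 2 + (M.pos u 1 - M.pos v 1) ^ 2 = 1 := by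
  have := M.unit u v h
  rw [EuclideanSpace.dist_eq] at this
  have h2 := congrArg (fun t => t ^ 2) this
  simp only [one_pow] at h2
  rw [Real.sq_sqrt (by positivity)] at h2
  simpa [Fin.sum_univ_two, Real.dist_eq, sq_abs] using h2

/-- the combinatorial drawing attached to an embedding -/
noncomputable def toPG (ε : ℝ) (hε : Function.Injective (fun v => M.pos v 0 + ε * M.pos v 1)) :
    PG (Fin n) {p : Fin n × Fin n // G.Adj p.1 p.2 ∧
      M.pos p.1 0 + ε * M.pos p.1 1 < M.pos p.2 0 + ε * M.pos p.2 1} where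
  x v := M.pos v 0 + ε * M.pos v 1
  y v := M.pos v 1
  L e := e.1.1
  R e := e.1.2
  xinj := hε
  lt e := e.2.2
  ext e e' h1 h2 := Subtype.ext (Prod.ext h1 h2)
  noc := by
    rintro ⟨⟨u, v⟩, hadj, hlt⟩ ⟨⟨a, b⟩, hadj', hlt'⟩ hne t h1 h2 h3 h4 heq
    simp only at *
    have hs : s(u, v) ≠ s(a, b) := by
      intro h
      rcases Sym2.eq_iff.1 h with ⟨rfl, rfl⟩ | ⟨rfl, rfl⟩
      · exact hne rfl
      · linarith
    have p1 : 0 < M.pos v 0 + ε * M.pos v 1 - (M.pos u 0 + ε * M.pos u 1) := by linarith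
    have p2 : 0 < M.pos b 0 + ε * M.pos b 1 - (M.pos a 0 + ε * M.pos a 1) := by linarith
    obtain ⟨r, hr⟩ : ∃ r, r = (t - (M.pos u 0 + ε * M.pos u 1)) /
      (M.pos v 0 + ε * M.pos v 1 - (M.pos u 0 + ε * M.pos u 1)) := ⟨_, rfl⟩
    obtain ⟨r', hr'⟩ : ∃ r, r = (t - (M.pos a 0 + ε * M.pos a 1)) /
      (M.pos b 0 + ε * M.pos b 1 - (M.pos a 0 + ε * M.pos a 1)) := ⟨_, rfl⟩
    have r0 : 0 ≤ r := by rw [hr]; exact div_nonneg (by linarith) p1.le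
    have r1 : r ≤ 1 := by rw [hr, div_le_one p1]; linarith
    have r0' : 0 ≤ r' := by rw [hr']; exact div_nonneg (by linarith) p2.le
    have r1' : r' ≤ 1 := by rw [hr', div_le_one p2]; linarith
    have hy : M.pos u 1 + r * (M.pos v 1 - M.pos u 1) = M.pos a 1 + r' * (M.pos b 1 - M.pos a 1) := by
      rw [hr, hr', div_mul_eq_mul_div, div_mul_eq_mul_div]
      rw [mul_div_assoc', mul_div_assoc'] at heq
      exact heq
    have e1 : r * (M.pos v 0 + ε * M.pos v 1 - (M.pos u 0 + ε * M.pos u 1)) =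
      (t - (M.pos u 0 + ε * M.pos u 1)) := by rw [hr, div_mul_cancel₀ _ p1.ne']
    have e2 : r' * (M.pos b 0 + ε * M.pos b 1 - (M.pos a 0 + ε * M.pos a 1)) =
      (t - (M.pos a 0 + ε * M.pos a 1)) := by rw [hr', div_mul_cancel₀ _ p2.ne']
    have hZ : (1 - r) • M.pos u + r • M.pos v = (1 - r') • M.pos a + r' • M.pos b := by
      apply ext2
      · simp only [PiLp.add_apply, PiLp.smul_apply, smul_eq_mul]
        linear_combination e1 - e2 - ε * hy
      · simp only [PiLp.add_apply, PiLp.smul_apply, smul_eq_mul]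
        linear_combination hy
    have m1 : (1 - r) • M.pos u + r • M.pos v ∈ segment ℝ (M.pos u) (M.pos v) := by
      rw [segment_eq_image]; exact ⟨r, ⟨r0, r1⟩, rfl⟩
    have m2 : (1 - r) • M.pos u + r • M.pos v ∈ segment ℝ (M.pos a) (M.pos b) := by
      rw [hZ, segment_eq_image]; exact ⟨r', ⟨r0', r1'⟩, rfl⟩
    have hm := M.noncross u v a b hadj hadj' hs ⟨m1, m2⟩
    have hxZ : ∀ z, (1 - r) • M.pos u + r • M.pos v = M.pos z → M.pos z 0 + ε * M.pos z 1 = t := by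
      intro z hz
      rw [← hz]
      simp only [PiLp.add_apply, PiLp.smul_apply, smul_eq_mul]
      linear_combination e1
    obtain ⟨k1, k2⟩ := hm
    simp only [Set.mem_insert_iff, Set.mem_singleton_iff] at k1 k2
    rcases k1 with k1 | k1
    · refine ⟨u, Or.inl rfl, ?_, hxZ u k1⟩
      rcases k2 with k2 | k2
      · left; exact M.inj (k1.symm.trans k2)
      · right; exact M.inj (k1.symm.trans k2)
    · refine ⟨v, Or.inr rfl, ?_, hxZ v k1⟩
      rcases k2 with k2 | k2
      · left; exact M.inj (k1.symm.trans k2)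
      · right; exact M.inj (k1.symm.trans k2)
  nov := by
    rintro ⟨⟨u, v⟩, hadj, hlt⟩ w h1 h2 heq
    simp only at *
    have p1 : 0 < M.pos v 0 + ε * M.pos v 1 - (M.pos u 0 + ε * M.pos u 1) := by linarith
    obtain ⟨r, hr⟩ : ∃ r, r = (M.pos w 0 + ε * M.pos w 1 - (M.pos u 0 + ε * M.pos u 1)) /
      (M.pos v 0 + ε * M.pos v 1 - (M.pos u 0 + ε * M.pos u 1)) := ⟨_, rfl⟩
    have r0 : 0 < r := by rw [hr]; exact div_pos (by linarith) p1
    have r1 : r < 1 := by rw [hr, div_lt_one p1]; linarith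
    have hy : M.pos u 1 + r * (M.pos v 1 - M.pos u 1) = M.pos w 1 := by
      rw [hr, div_mul_eq_mul_div]
      rw [mul_div_assoc'] at heq
      exact heq
    have e1 : r * (M.pos v 0 + ε * M.pos v 1 - (M.pos u 0 + ε * M.pos u 1)) =
      (M.pos w 0 + ε * M.pos w 1 - (M.pos u 0 + ε * M.pos u 1)) := by
        rw [hr, div_mul_cancel₀ _ p1.ne']
    apply M.noVertexInterior w u v hadj
    rw [openSegment_eq_image]
    refine ⟨r, ⟨r0, r1⟩, ?_⟩
    apply ext2
    · simp only [PiLp.add_apply, PiLp.smul_apply, smul_eq_mul]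
      linear_combination e1 - ε * hy
    · simp only [PiLp.add_apply, PiLp.smul_apply, smul_eq_mul]
      linear_combination hy

theorem edge_bound (M : MatchstickEmbedding G) (hG : G.CliqueFree 3) (hpos : 0 < G.edgeSet.ncard) :
    ∃ D : ℕ, G.edgeSet.ncard + D = 2 * n ∧ 2 * n ≤ 25 * D ^ 2 := by
  obtain ⟨ε, hε⟩ := exists_tilt (fun v => M.pos v 0) (fun v => M.pos v 1)
    (fun u v h0 h1 => M.inj (ext2 h0 h1))
  let P := toPG M ε hε
  have hadj : ∀ u v, P.adj u v → G.Adj u v := by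
    rintro u v ⟨e, ⟨rfl, rfl⟩ | ⟨rfl, rfl⟩⟩
    · exact e.2.1
    · exact e.2.1.symm
  have hcard : Fintype.card {p : Fin n × Fin n // G.Adj p.1 p.2 ∧
      M.pos p.1 0 + ε * M.pos p.1 1 < M.pos p.2 0 + ε * M.pos p.2 1} = G.edgeSet.ncard := by
    rw [← Nat.card_eq_fintype_card, ← Nat.card_coe_set_eq]
    refine Nat.card_eq_of_bijective (fun p => (⟨s(p.1.1, p.1.2), p.2.1⟩ : G.edgeSet)) ⟨?_, ?_⟩
    · rintro ⟨⟨u, v⟩, h1, h2⟩ ⟨⟨a, b⟩, h3, h4⟩ h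
      replace h := congrArg Subtype.val h
      rcases Sym2.eq_iff.1 h with ⟨rfl, rfl⟩ | ⟨rfl, rfl⟩
      · rfl
      · simp only at h2 h4; linarith
    · rintro ⟨e, he⟩
      induction e using Sym2.ind with
      | _ u v =>
      have hne : u ≠ v := G.ne_of_adj he
      rcases lt_or_gt_of_ne (fun h => hne (hε h)) with h | h
      · exact ⟨⟨(u, v), he, h⟩, rfl⟩
      · exact ⟨⟨(v, u), SimpleGraph.Adj.symm (G := G) he, h⟩, Subtype.ext Sym2.eq_swap⟩
  have hne : Nonempty {p : Fin n × Fin n // G.Adj p.1 p.2 ∧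
      M.pos p.1 0 + ε * M.pos p.1 1 < M.pos p.2 0 + ε * M.pos p.2 1} := by
    rw [← Fintype.card_pos_iff, hcard]; exact hpos
  have := P.upper (by
    intro u v z h1 h2 h3
    have := hG {u, v, z}
    rw [SimpleGraph.is3Clique_triple_iff] at this
    exact this ⟨hadj _ _ h1, (hadj _ _ h3).symm, hadj _ _ h2⟩) (by
    intro a b c d h1 h2 h3 h4 hac hbd
    obtain ⟨k0, k1⟩ := rhombus_alg (unit_sq M (hadj _ _ h1)) (unit_sq M (hadj _ _ h2))
      (unit_sq M (hadj _ _ h3)) (unit_sq M (hadj _ _ h4))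
      (fun h => hac (M.inj (ext2 h.1 h.2))) (fun h => hbd (M.inj (ext2 h.1 h.2)))
    refine ⟨?_, k1⟩
    change M.pos a 0 + ε * M.pos a 1 + (M.pos c 0 + ε * M.pos c 1) =
      M.pos b 0 + ε * M.pos b 1 + (M.pos d 0 + ε * M.pos d 1)
    linear_combination k0 + ε * k1)
  rw [hcard, Fintype.card_fin] at this
  exact this

end conn

lemma edges_bddAbove (n : ℕ) : BddAbove {e : ℕ | ∃ G : SimpleGraph (Fin n),
    G.CliqueFree 3 ∧ Nonempty (MatchstickEmbedding G) ∧ e = G.edgeSet.ncard} := by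
  refine ⟨(Set.univ : Set (Sym2 (Fin n))).ncard, ?_⟩
  rintro e ⟨G, -, -, rfl⟩
  exact Set.ncard_le_ncard (Set.subset_univ _) (Set.toFinite _)

/-- the upper bound -/
theorem upper_bound (n : ℕ) (hn : 1 ≤ n) :
    (maxTriangleFreeMatchstickEdges n : ℝ) ≤ 2 * n - Real.sqrt 2 / 5 * Real.sqrt n := by
  have hsq : ∀ D : ℝ, 0 ≤ D → 2 * (n : ℝ) ≤ 25 * D ^ 2 → Real.sqrt 2 / 5 * Real.sqrt n ≤ D := by
    intro D hD h
    have : Real.sqrt 2 * Real.sqrt n ≤ 5 * D := by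
      rw [← Real.sqrt_mul (by norm_num)]
      rw [Real.sqrt_le_left (by linarith)]
      nlinarith
    linarith
  have hn' : (1 : ℝ) ≤ n := by exact_mod_cast hn
  have hall : ∀ e : ℕ, e ∈ {e : ℕ | ∃ G : SimpleGraph (Fin n),
    G.CliqueFree 3 ∧ Nonempty (MatchstickEmbedding G) ∧ e = G.edgeSet.ncard} →
      (e : ℝ) ≤ 2 * n - Real.sqrt 2 / 5 * Real.sqrt n := by
    rintro e ⟨G, hG, ⟨M⟩, rfl⟩
    rcases Nat.eq_zero_or_pos G.edgeSet.ncard with h | h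
    · rw [h]
      have := hsq (2 * n) (by linarith) (by nlinarith)
      push_cast; linarith
    · obtain ⟨D, h1, h2⟩ := edge_bound M hG h
      have h1' : (G.edgeSet.ncard : ℝ) + D = 2 * n := by exact_mod_cast h1
      have h2' : 2 * (n : ℝ) ≤ 25 * (D : ℝ) ^ 2 := by exact_mod_cast h2
      have := hsq D (by positivity) h2'
      linarith
  by_cases hne : {e : ℕ | ∃ G : SimpleGraph (Fin n),
    G.CliqueFree 3 ∧ Nonempty (MatchstickEmbedding G) ∧ e = G.edgeSet.ncard}.Nonempty
  · exact hall _ (Nat.sSup_mem hne (edges_bddAbove n))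
  · unfold maxTriangleFreeMatchstickEdges
    rw [Set.not_nonempty_iff_eq_empty.1 hne]
    have := hsq (2 * n) (by linarith) (by nlinarith)
    simp only [csSup_empty, Nat.bot_eq_zero, Nat.cast_zero]
    linarith


/-- clamp to the unit interval -/
noncomputable def lbClamp (y : ℝ) : ℝ := max 0 (min 1 y)

lemma lbClamp_mono {x y : ℝ} (h : x ≤ y) : lbClamp x ≤ lbClamp y :=
  max_le_max le_rfl (min_le_min le_rfl h)

lemma lbClamp_of_nonpos {x : ℝ} (h : x ≤ 0) : lbClamp x = 0 := by
  unfold lbClamp; exact max_eq_left ((min_le_right _ _).trans h)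

lemma lbClamp_of_one_le {x : ℝ} (h : 1 ≤ x) : lbClamp x = 1 := by
  unfold lbClamp; rw [min_eq_left h]; norm_num

lemma lbClamp_of_mem {x : ℝ} (h0 : 0 ≤ x) (h : x ≤ 1) : lbClamp x = x := by
  unfold lbClamp; rw [min_eq_right h, max_eq_right h0]

lemma lbClamp_lt {x y : ℝ} (h : x < y) (h0 : 0 < y) (h1 : x < 1) : lbClamp x < lbClamp y := by
  unfold lbClamp
  rcases le_total x 0 with hx | hx
  · rw [max_eq_left ((min_le_right _ _).trans hx)]
    exact lt_max_of_lt_right (lt_min one_pos h0)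
  · rw [min_eq_right h1.le, max_eq_right hx]
    exact lt_max_of_lt_right (lt_min h1 h)

/-- normalising constants -/
noncomputable def lbC (l : ℕ) : ℝ := 1 / Real.sqrt (1 + (l : ℝ) ^ 2)

lemma lbC_pos (l : ℕ) : 0 < lbC l := by unfold lbC; positivity

lemma lbC_sq (l : ℕ) : (lbC l) ^ 2 * (1 + (l : ℝ) ^ 2) = 1 := by
  unfold lbC
  have h : (0 : ℝ) < 1 + (l : ℝ) ^ 2 := by positivity
  rw [div_pow, Real.sq_sqrt h.le]; field_simp

/-- first coordinate of the convex polygonal curve -/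
noncomputable def lbX (N : ℕ) (x : ℝ) : ℝ := ∑ l ∈ Finset.range N, lbC l * lbClamp (x - l)

/-- second coordinate of the convex polygonal curve -/
noncomputable def lbY (N : ℕ) (x : ℝ) : ℝ := ∑ l ∈ Finset.range N, lbC l * l * lbClamp (x - l)

lemma lb_floor {N : ℕ} {x : ℝ} (h0 : 0 ≤ x) (h : x < N) :
    ∃ l ∈ Finset.range N, (l : ℝ) ≤ x ∧ x < l + 1 := by
  refine ⟨⌊x⌋₊, ?_, Nat.floor_le h0, Nat.lt_floor_add_one x⟩
  rw [Finset.mem_range, Nat.floor_lt h0]; exact h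

lemma lbX_lt {N : ℕ} {x y : ℝ} (h0 : 0 ≤ x) (h : x < y) (hN : y ≤ N) : lbX N x < lbX N y := by
  obtain ⟨l, hl, h1, h2⟩ := lb_floor h0 (h.trans_le hN)
  refine Finset.sum_lt_sum (fun i _ => ?_) ⟨l, hl, ?_⟩
  · exact mul_le_mul_of_nonneg_left (lbClamp_mono (by linarith)) (lbC_pos i).le
  · exact mul_lt_mul_of_pos_left (lbClamp_lt (by linarith) (by linarith) (by linarith)) (lbC_pos l)

lemma lbX_inj {N : ℕ} {x y : ℝ} (hx : 0 ≤ x) (hx' : x ≤ N) (hy : 0 ≤ y) (hy' : y ≤ N)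
    (h : lbX N x = lbX N y) : x = y := by
  rcases lt_trichotomy x y with h1 | h1 | h1
  · exact absurd h (lbX_lt hx h1 hy').ne
  · exact h1
  · exact absurd h (lbX_lt hy h1 hx').ne'

lemma lbL_eq (N b : ℕ) (x : ℝ) : lbY N x - b * lbX N x =
    ∑ l ∈ Finset.range N, lbC l * ((l : ℝ) - b) * lbClamp (x - l) := by
  unfold lbX lbY
  rw [Finset.mul_sum, ← Finset.sum_sub_distrib]
  exact Finset.sum_congr rfl fun l _ => by ring

lemma lbL_anti_term {b l : ℕ} {x y : ℝ} (h : x ≤ y) (hb : y ≤ b + 1) :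
    lbC l * ((l : ℝ) - b) * lbClamp (y - l) ≤ lbC l * ((l : ℝ) - b) * lbClamp (x - l) := by
  rcases le_or_gt l b with hl | hl
  · have hl' : (l : ℝ) ≤ b := by exact_mod_cast hl
    exact mul_le_mul_of_nonpos_left (lbClamp_mono (by linarith))
      (mul_nonpos_of_nonneg_of_nonpos (lbC_pos l).le (by linarith))
  · have hl' : (b : ℝ) + 1 ≤ l := by exact_mod_cast hl
    rw [lbClamp_of_nonpos (x := y - l) (by linarith), lbClamp_of_nonpos (x := x - l) (by linarith)]

lemma lbL_mono_term {b l : ℕ} {x y : ℝ} (h : x ≤ y) (hb : b ≤ x) :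
    lbC l * ((l : ℝ) - b) * lbClamp (x - l) ≤ lbC l * ((l : ℝ) - b) * lbClamp (y - l) := by
  rcases le_or_gt b l with hl | hl
  · have hl' : (b : ℝ) ≤ l := by exact_mod_cast hl
    exact mul_le_mul_of_nonneg_left (lbClamp_mono (by linarith))
      (mul_nonneg (lbC_pos l).le (by linarith))
  · have hl' : (l : ℝ) + 1 ≤ b := by exact_mod_cast hl
    rw [lbClamp_of_one_le (x := y - l) (by linarith), lbClamp_of_one_le (x := x - l) (by linarith)]

lemma lbL_anti (N : ℕ) {b : ℕ} {x y : ℝ} (h : x ≤ y) (hb : y ≤ b + 1) :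
    lbY N y - b * lbX N y ≤ lbY N x - b * lbX N x := by
  rw [lbL_eq, lbL_eq]
  exact Finset.sum_le_sum fun l _ => lbL_anti_term h hb

lemma lbL_mono (N : ℕ) {b : ℕ} {x y : ℝ} (h : x ≤ y) (hb : b ≤ x) :
    lbY N x - b * lbX N x ≤ lbY N y - b * lbX N y := by
  rw [lbL_eq, lbL_eq]
  exact Finset.sum_le_sum fun l _ => lbL_mono_term h hb

lemma lbL_anti_strict {N : ℕ} {b : ℕ} {x y : ℝ} (h0 : 0 ≤ x) (h : x < y) (hN : y ≤ N)
    (hb : y ≤ b + 1) (hx : x < b) :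
    lbY N y - b * lbX N y < lbY N x - b * lbX N x := by
  rw [lbL_eq, lbL_eq]
  obtain ⟨l, hl, h1, h2⟩ := lb_floor h0 (h.trans_le hN)
  refine Finset.sum_lt_sum (fun l _ => lbL_anti_term h.le hb) ⟨l, hl, ?_⟩
  exact mul_lt_mul_of_neg_left (lbClamp_lt (by linarith) (by linarith) (by linarith))
    (mul_neg_of_pos_of_neg (lbC_pos l) (by linarith))

lemma lbL_mono_strict {N : ℕ} {b : ℕ} {x y : ℝ} (h : x < y) (hN : y ≤ N)
    (hb : b ≤ x) (hx : (b : ℝ) + 1 < y) :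
    lbY N x - b * lbX N x < lbY N y - b * lbX N y := by
  have h0 : (0 : ℝ) ≤ b := by positivity
  have h1 : (b : ℝ) + 1 ≤ max x (b + 1) := le_max_right _ _
  have h2 : x ≤ max x (b + 1) := le_max_left _ _
  have h3 : max x (b + 1) < y := max_lt h hx
  refine (lbL_mono N h2 hb).trans_lt ?_
  rw [lbL_eq, lbL_eq]
  obtain ⟨l, hl, h4, h5⟩ := lb_floor (N := N) (x := max x (b + 1)) (by linarith) (h3.trans_le hN)
  refine Finset.sum_lt_sum (fun l _ => lbL_mono_term h3.le (by linarith)) ⟨l, hl, ?_⟩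
  exact mul_lt_mul_of_pos_left (lbClamp_lt (by linarith) (by linarith) (by linarith))
    (mul_pos (lbC_pos l) (by linarith))

/-- Two non-overlapping chords of the curve that are equal as vectors lie in one linear piece. -/
lemma lb_core {N : ℕ} {p q r w : ℝ} (h0 : 0 ≤ p) (hpq : p < q) (hqr : q ≤ r) (hrw : r < w)
    (hw : w ≤ N) (hX : lbX N q - lbX N p = lbX N w - lbX N r)
    (hY : lbY N q - lbY N p = lbY N w - lbY N r) :
    ∃ b : ℕ, (b : ℝ) ≤ p ∧ w ≤ b + 1 := by
  have hq : 0 < q := by linarith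
  have hc : 0 < ⌈q⌉₊ := Nat.ceil_pos.2 hq
  obtain ⟨b, hb⟩ : ∃ b, ⌈q⌉₊ = b + 1 := ⟨⌈q⌉₊ - 1, by omega⟩
  have hb1 : q ≤ b + 1 := by
    have := Nat.le_ceil q; rw [hb] at this; exact_mod_cast this
  have hb2 : (b : ℝ) < q := by
    have := Nat.ceil_lt_add_one hq.le; rw [hb] at this; push_cast at this; linarith
  have e : (lbY N q - b * lbX N q) - (lbY N p - b * lbX N p) =
      (lbY N w - b * lbX N w) - (lbY N r - b * lbX N r) := by
    linear_combination hY - b * hX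
  refine ⟨b, ?_, ?_⟩
  · by_contra hcon
    have := lbL_anti_strict (N := N) h0 hpq (by linarith) hb1 (not_le.1 hcon)
    have := lbL_mono N (b := b) hrw.le (by linarith)
    linarith
  · by_contra hcon
    have := lbL_mono_strict hrw hw (b := b) (by linarith) (not_le.1 hcon)
    have := lbL_anti N hpq.le hb1
    linarith

lemma lb_chord_lt {N : ℕ} {t s t' s' : ℝ} (h0 : 0 ≤ t) (hts : t ≤ s) (hts' : t' ≤ s')
    (hs : s' ≤ N) (htt : t < t')
    (hX : lbX N s - lbX N t = lbX N s' - lbX N t')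
    (hY : lbY N s - lbY N t = lbY N s' - lbY N t') (hsN : s ≤ N) :
    (t = s ∧ t' = s') ∨
      (t < s ∧ t' < s' ∧ s < s' ∧ ∃ b : ℕ, (b : ℝ) ≤ t ∧ s' ≤ b + 1) := by
  rcases hts.eq_or_lt with h | h
  · left
    refine ⟨h, lbX_inj (N := N) (by linarith) (by linarith) (by linarith) hs ?_⟩
    rw [h] at hX; linarith
  · right
    have hlt := lbX_lt (N := N) h0 h hsN
    have h' : t' < s' := by
      rcases hts'.eq_or_lt with h' | h'
      · rw [h'] at hX; linarith
      · exact h'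
    have hss : s < s' := by
      by_contra hcon
      rcases (not_lt.1 hcon).eq_or_lt with h2 | h2
      · rw [h2] at hX
        have := lbX_lt (N := N) h0 htt (by linarith)
        linarith
      · have := lbX_lt (N := N) h0 htt (by linarith)
        have := lbX_lt (N := N) (by linarith) h2 hsN
        linarith
    refine ⟨h, h', hss, ?_⟩
    rcases le_or_gt t' s with h3 | h3
    · exact lb_core h0 htt h3 hss hs (by linarith) (by linarith)
    · exact lb_core h0 h h3.le h' hs hX hY

lemma lb_clamp_step (j l : ℕ) (α : ℝ) (h0 : 0 ≤ α) (h1 : α ≤ 1) :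
    lbClamp ((j : ℝ) + α - l) - lbClamp ((j : ℝ) - l) = if l = j then α else 0 := by
  split_ifs with h
  · subst h
    rw [lbClamp_of_mem (x := (l : ℝ) + α - l) (by linarith) (by linarith),
      lbClamp_of_nonpos (x := (l : ℝ) - l) (by linarith)]; ring
  · rcases lt_or_gt_of_ne h with h | h
    · have h' : (l : ℝ) + 1 ≤ j := by exact_mod_cast h
      rw [lbClamp_of_one_le (by linarith), lbClamp_of_one_le (by linarith)]; ring
    · have h' : (j : ℝ) + 1 ≤ l := by exact_mod_cast h
      rw [lbClamp_of_nonpos (by linarith), lbClamp_of_nonpos (by linarith)]; ring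

lemma lbX_step {N j : ℕ} (hj : j < N) {α : ℝ} (h0 : 0 ≤ α) (h1 : α ≤ 1) :
    lbX N (j + α) = lbX N j + α * lbC j := by
  have : lbX N (j + α) - lbX N j = α * lbC j := by
    unfold lbX
    rw [← Finset.sum_sub_distrib]
    simp_rw [← mul_sub, lb_clamp_step _ _ α h0 h1]
    simp [hj, mul_comm]
  linarith

lemma lbY_step {N j : ℕ} (hj : j < N) {α : ℝ} (h0 : 0 ≤ α) (h1 : α ≤ 1) :
    lbY N (j + α) = lbY N j + α * (lbC j * j) := by
  have : lbY N (j + α) - lbY N j = α * (lbC j * j) := by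
    unfold lbY
    rw [← Finset.sum_sub_distrib]
    simp_rw [← mul_sub, lb_clamp_step _ _ α h0 h1]
    simp [hj, mul_comm]
  linarith


/-- chord vector of the curve -/
noncomputable def lbP (N : ℕ) (t s : ℝ) : EuclideanSpace ℝ (Fin 2) :=
  !₂[lbX N s - lbX N t, lbY N s - lbY N t]

lemma lbP_self (N : ℕ) (t s : ℝ) : lbP N t t = lbP N s s := by
  unfold lbP; simp

lemma lbP_eq {N : ℕ} {t s t' s' : ℝ} (h : lbP N t s = lbP N t' s') :
    lbX N s - lbX N t = lbX N s' - lbX N t' ∧ lbY N s - lbY N t = lbY N s' - lbY N t' := by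
  have h0 := congrArg (fun v : EuclideanSpace ℝ (Fin 2) => v 0) h
  have h1 := congrArg (fun v : EuclideanSpace ℝ (Fin 2) => v 1) h
  simp only [lbP] at h0 h1
  exact ⟨by simpa using h0, by simpa using h1⟩

/-- normal form of an interval -/
def lbNrm (p : ℕ × ℕ) : ℕ × ℕ := if p.1 = p.2 then (0, 0) else p

/-- position of an interval -/
noncomputable def lbPos (N : ℕ) (p : ℕ × ℕ) : EuclideanSpace ℝ (Fin 2) := lbP N p.1 p.2

lemma lbPos_nrm (N : ℕ) (p : ℕ × ℕ) : lbPos N (lbNrm p) = lbPos N p := by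
  unfold lbNrm lbPos
  split_ifs with h
  · rw [h]; exact lbP_self N _ _
  · rfl

/-- `q` is a parent of `p` -/
def lbPar (p q : ℕ × ℕ) : Prop :=
  p.1 < p.2 ∧ (q = lbNrm (p.1, p.2 - 1) ∨ q = lbNrm (p.1 + 1, p.2))

/-- the chord `t s` lies on the edge `p q` -/
def lbOn (p q : ℕ × ℕ) (t s : ℝ) : Prop :=
  p.1 < p.2 ∧ ((q = lbNrm (p.1, p.2 - 1) ∧ t = p.1 ∧ (p.2 : ℝ) - 1 ≤ s ∧ s ≤ p.2) ∨
    (q = lbNrm (p.1 + 1, p.2) ∧ s = p.2 ∧ (p.1 : ℝ) ≤ t ∧ t ≤ p.1 + 1))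

lemma lbPar.len {p q : ℕ × ℕ} (h : lbPar p q) : (q.2 : ℤ) - q.1 = p.2 - p.1 - 1 := by
  obtain ⟨⟨i, j⟩, q⟩ := (p, q)
  obtain ⟨h1, h2 | h2⟩ := h <;> subst h2 <;> simp only [lbNrm] at * <;> split_ifs with h3 <;>
    simp only at * <;> omega

lemma lb_step_right {N j : ℕ} (i : ℝ) (hj : j < N) {α : ℝ} (h0 : 0 ≤ α) (h1 : α ≤ 1) :
    lbP N i (j + α) = lbP N i j + α • !₂[lbC j, lbC j * j] := by
  unfold lbP
  rw [lbX_step hj h0 h1, lbY_step hj h0 h1]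
  ext k; fin_cases k <;> simp <;> ring

lemma lb_step_left {N i : ℕ} (j : ℝ) (hi : i < N) {α : ℝ} (h0 : 0 ≤ α) (h1 : α ≤ 1) :
    lbP N (i + α) j = lbP N i j - α • !₂[lbC i, lbC i * i] := by
  unfold lbP
  rw [lbX_step hi h0 h1, lbY_step hi h0 h1]
  ext k; fin_cases k <;> simp <;> ring

lemma lb_norm (l : ℕ) : ‖(!₂[lbC l, lbC l * l] : EuclideanSpace ℝ (Fin 2))‖ = 1 := by
  rw [EuclideanSpace.norm_eq, Real.sqrt_eq_one]
  have := lbC_sq l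
  simp [Fin.sum_univ_two]
  linear_combination this

lemma lb_par_unit {N : ℕ} {p q : ℕ × ℕ} (h : lbPar p q) (hN : p.2 ≤ N) :
    dist (lbPos N p) (lbPos N q) = 1 := by
  obtain ⟨i, j⟩ := p
  obtain ⟨h1, h2 | h2⟩ := h
  · subst h2
    simp only at *
    obtain ⟨k, rfl⟩ : ∃ k, j = k + 1 := ⟨j - 1, by omega⟩
    rw [lbPos_nrm]
    unfold lbPos
    simp only [Nat.add_sub_cancel]
    push_cast
    rw [lb_step_right _ (by omega) zero_le_one le_rfl, dist_eq_norm]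
    simp only [one_smul, add_sub_cancel_left]
    exact lb_norm k
  · subst h2
    simp only at *
    rw [lbPos_nrm]
    unfold lbPos
    simp only
    push_cast
    rw [lb_step_left _ (by omega) zero_le_one le_rfl, dist_eq_norm]
    simp only [one_smul, sub_sub_cancel]
    exact lb_norm i

lemma lb_seg {N : ℕ} {p q : ℕ × ℕ} (h : lbPar p q) (hN : p.2 ≤ N)
    {z : EuclideanSpace ℝ (Fin 2)} (hz : z ∈ segment ℝ (lbPos N p) (lbPos N q)) :
    ∃ t s, lbOn p q t s ∧ z = lbP N t s := by
  obtain ⟨a, b, ha, hb, hab, rfl⟩ := hz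
  obtain ⟨i, j⟩ := p
  obtain ⟨h1, h2 | h2⟩ := h
  · subst h2
    simp only at *
    obtain ⟨k, rfl⟩ : ∃ k, j = k + 1 := ⟨j - 1, by omega⟩
    refine ⟨i, k + a, ⟨h1, Or.inl ⟨rfl, rfl, ?_, ?_⟩⟩, ?_⟩
    · push_cast; linarith
    · push_cast; linarith
    · rw [lbPos_nrm]
      unfold lbPos
      simp only [Nat.add_sub_cancel]
      push_cast
      rw [lb_step_right _ (by omega) zero_le_one le_rfl, lb_step_right _ (by omega) ha (by linarith)]
      obtain rfl : b = 1 - a := by linarith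
      module
  · subst h2
    simp only at *
    refine ⟨i + b, j, ⟨h1, Or.inr ⟨rfl, rfl, ?_, ?_⟩⟩, ?_⟩
    · simp only; linarith
    · simp only; linarith
    · rw [lbPos_nrm]
      unfold lbPos
      simp only
      push_cast
      rw [lb_step_left _ (by omega) zero_le_one le_rfl, lb_step_left _ (by omega) hb (by linarith)]
      obtain rfl : a = 1 - b := by linarith
      module

lemma lbOn.bounds {p q : ℕ × ℕ} {t s : ℝ} (h : lbOn p q t s) :
    0 ≤ t ∧ t ≤ s ∧ s ≤ p.2 := by
  obtain ⟨i, j⟩ := p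
  obtain ⟨h1, ⟨-, h2, h3, h4⟩ | ⟨-, h2, h3, h4⟩⟩ := h
  · simp only at *
    have : (i : ℝ) + 1 ≤ j := by exact_mod_cast h1
    have : (0 : ℝ) ≤ i := by positivity
    refine ⟨?_, ?_, ?_⟩ <;> linarith
  · simp only at *
    have : (i : ℝ) + 1 ≤ j := by exact_mod_cast h1
    have : (0 : ℝ) ≤ i := by positivity
    refine ⟨?_, ?_, ?_⟩ <;> linarith

/-- integer chord on an edge is an endpoint -/
lemma lbOn.int {N : ℕ} {p q : ℕ × ℕ} {t s : ℕ} (h : lbOn p q t s) :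
    lbP N t s = lbPos N p ∨ lbP N t s = lbPos N q := by
  obtain ⟨i, j⟩ := p
  obtain ⟨h1, ⟨hq, h2, h3, h4⟩ | ⟨hq, h2, h3, h4⟩⟩ := h
  · simp only at *
    obtain ⟨k, rfl⟩ : ∃ k, j = k + 1 := ⟨j - 1, by omega⟩
    have h2 : t = i := by exact_mod_cast h2
    have h3 : k ≤ s := by push_cast at h3; have : (k : ℝ) ≤ s := by linarith
                          exact_mod_cast this
    have h4 : s ≤ k + 1 := by exact_mod_cast h4
    subst hq h2
    rw [lbPos_nrm]
    simp only [Nat.add_sub_cancel, lbPos]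
    rcases h3.eq_or_lt with h | h
    · right; rw [h]
    · left; rw [show s = k + 1 by omega]
  · simp only at *
    have h2 : s = j := by exact_mod_cast h2
    have h3 : i ≤ t := by exact_mod_cast h3
    have h4 : t ≤ i + 1 := by exact_mod_cast h4
    subst hq h2
    rw [lbPos_nrm]
    simp only [lbPos]
    rcases h3.eq_or_lt with h | h
    · left; rw [h]
    · right; rw [show t = i + 1 by omega]

lemma lb_same {N : ℕ} {p q p' q' : ℕ × ℕ} {t s : ℝ} (h : lbOn p q t s) (h' : lbOn p' q' t s)
    (hne : ¬ (p = p' ∧ q = q')) : ∃ m n : ℕ, t = m ∧ s = n := by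
  obtain ⟨i, j⟩ := p
  obtain ⟨i', j'⟩ := p'
  obtain ⟨h1, ⟨hq, h2, h3, h4⟩ | ⟨hq, h2, h3, h4⟩⟩ := h <;>
  obtain ⟨h1', ⟨hq', h2', h3', h4'⟩ | ⟨hq', h2', h3', h4'⟩⟩ := h' <;> simp only at *
  · have e : i = i' := by rw [h2] at h2'; exact_mod_cast h2'
    subst e
    have hj : j ≠ j' := by rintro rfl; exact hne ⟨rfl, hq.trans hq'.symm⟩
    rcases lt_or_gt_of_ne hj with hl | hl
    · have : (j : ℝ) + 1 ≤ j' := by exact_mod_cast hl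
      exact ⟨i, j, h2, by linarith⟩
    · have : (j' : ℝ) + 1 ≤ j := by exact_mod_cast hl
      exact ⟨i, j', h2, by linarith⟩
  · exact ⟨i, j', h2, h2'⟩
  · exact ⟨i', j, h2', h2⟩
  · have e : j = j' := by rw [h2] at h2'; exact_mod_cast h2'
    subst e
    have hj : i ≠ i' := by rintro rfl; exact hne ⟨rfl, hq.trans hq'.symm⟩
    rcases lt_or_gt_of_ne hj with hl | hl
    · have : (i : ℝ) + 1 ≤ i' := by exact_mod_cast hl
      exact ⟨i', j, by linarith, h2⟩
    · have : (i' : ℝ) + 1 ≤ i := by exact_mod_cast hl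
      exact ⟨i, j, by linarith, h2⟩

lemma lbOn.zero {N : ℕ} {p q : ℕ × ℕ} {t s : ℝ} (h : lbOn p q t s) (hts : t = s) :
    lbP N t s = lbPos N q := by
  obtain ⟨i, j⟩ := p
  obtain ⟨h1, ⟨hq, h2, h3, h4⟩ | ⟨hq, h2, h3, h4⟩⟩ := h <;> simp only at *
  · have : i + 1 = j := by
      apply le_antisymm h1
      have : (j : ℝ) ≤ i + 1 := by linarith
      exact_mod_cast this
    subst this
    rw [hq, lbPos_nrm, hts]; exact lbP_self N _ _
  · have : i + 1 = j := by
      apply le_antisymm h1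
      have : (j : ℝ) ≤ i + 1 := by linarith
      exact_mod_cast this
    subst this
    rw [hq, lbPos_nrm, hts]; exact lbP_self N _ _

lemma lb_piece {N : ℕ} {p q p' q' : ℕ × ℕ} {t s t' s' : ℝ} (h : lbOn p q t s)
    (h' : lbOn p' q' t' s') {b : ℕ} (htt : t < t') (hts : t < s) (hts' : t' < s') (hss : s < s')
    (hb : (b : ℝ) ≤ t) (hb' : s' ≤ b + 1) : p = p' ∧ q = q' := by
  have k1 : p = (b, b + 1) ∧ q = (0, 0) := by
    obtain ⟨i, j⟩ := p
    obtain ⟨h1, ⟨hq, h2, h3, h4⟩ | ⟨hq, h2, h3, h4⟩⟩ := h <;> simp only at *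
    · have e1 : b ≤ i := by rw [h2] at hb; exact_mod_cast hb
      have e2 : j < b + 2 := by
        have : (j : ℝ) < b + 2 := by linarith
        exact_mod_cast this
      obtain rfl : i = b := by omega
      obtain rfl : j = i + 1 := by omega
      exact ⟨rfl, by rw [hq]; simp [lbNrm]⟩
    · exfalso
      have e1 : b < j := by
        have : (b : ℝ) < j := by linarith
        exact_mod_cast this
      have e2 : j < b + 1 := by
        have : (j : ℝ) < b + 1 := by linarith
        exact_mod_cast this
      omega
  have k2 : p' = (b, b + 1) ∧ q' = (0, 0) := by
    obtain ⟨i, j⟩ := p'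
    obtain ⟨h1, ⟨hq, h2, h3, h4⟩ | ⟨hq, h2, h3, h4⟩⟩ := h' <;> simp only at *
    · exfalso
      have e1 : b < i := by
        have : (b : ℝ) < i := by linarith
        exact_mod_cast this
      have e2 : i < b + 1 := by
        have : (i : ℝ) < b + 1 := by linarith
        exact_mod_cast this
      omega
    · have e1 : b < j := by
        have : (b : ℝ) < j := by linarith
        exact_mod_cast this
      have e2 : j ≤ b + 1 := by
        have : (j : ℝ) ≤ b + 1 := by linarith
        exact_mod_cast this
      have e3 : b < i + 1 := by
        have : (b : ℝ) < i + 1 := by linarith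
        exact_mod_cast this
      obtain rfl : i = b := by omega
      obtain rfl : j = i + 1 := by omega
      exact ⟨rfl, by rw [hq]; simp [lbNrm]⟩
  exact ⟨k1.1.trans k2.1.symm, k1.2.trans k2.2.symm⟩

lemma lb_noncross {N : ℕ} {p q p' q' : ℕ × ℕ} (h : lbPar p q) (h' : lbPar p' q')
    (hN : p.2 ≤ N) (hN' : p'.2 ≤ N) (hne : ¬ (p = p' ∧ q = q'))
    {z : EuclideanSpace ℝ (Fin 2)} (hz : z ∈ segment ℝ (lbPos N p) (lbPos N q))
    (hz' : z ∈ segment ℝ (lbPos N p') (lbPos N q')) :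
    (z = lbPos N p ∨ z = lbPos N q) ∧ (z = lbPos N p' ∨ z = lbPos N q') := by
  obtain ⟨t, s, hon, hzt⟩ := lb_seg h hN hz
  obtain ⟨t', s', hon', hzt'⟩ := lb_seg h' hN' hz'
  have hNr : (p.2 : ℝ) ≤ N := by exact_mod_cast hN
  have hNr' : (p'.2 : ℝ) ≤ N := by exact_mod_cast hN'
  obtain ⟨b1, b2, b3⟩ := hon.bounds
  obtain ⟨b1', b2', b3'⟩ := hon'.bounds
  obtain ⟨eX, eY⟩ := lbP_eq (hzt.symm.trans hzt')
  rcases lt_trichotomy t t' with hl | hl | hl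
  · rcases lb_chord_lt b1 b2 b2' (b3'.trans hNr') hl eX eY (b3.trans hNr) with
      ⟨e1, e2⟩ | ⟨c1, c2, c3, b, c4, c5⟩
    · exact ⟨Or.inr (hzt.trans (hon.zero e1)), Or.inr (hzt'.trans (hon'.zero e2))⟩
    · exact absurd (lb_piece (N := N) hon hon' hl c1 c2 c3 c4 c5) hne
  · subst hl
    have : s = s' := lbX_inj (N := N) (by linarith) (by linarith) (by linarith) (by linarith)
      (by linarith)
    subst this
    obtain ⟨m, n, rfl, rfl⟩ := lb_same (N := N) hon hon' hne
    rw [hzt]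
    exact ⟨hon.int, hon'.int⟩
  · rcases lb_chord_lt b1' b2' b2 (b3.trans hNr) hl eX.symm eY.symm (b3'.trans hNr') with
      ⟨e1, e2⟩ | ⟨c1, c2, c3, b, c4, c5⟩
    · exact ⟨Or.inr (hzt.trans (hon.zero e2)), Or.inr (hzt'.trans (hon'.zero e1))⟩
    · have := lb_piece (N := N) hon' hon hl c1 c2 c3 c4 c5
      exact absurd ⟨this.1.symm, this.2.symm⟩ hne

/-- normalised intervals -/
def lbGood (p : ℕ × ℕ) : Prop := p.1 < p.2 ∨ p = (0, 0)

lemma lb_inj {N : ℕ} {p q : ℕ × ℕ} (hp : lbGood p) (hq : lbGood q) (hN : p.2 ≤ N) (hN' : q.2 ≤ N)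
    (h : lbPos N p = lbPos N q) : p = q := by
  obtain ⟨i, j⟩ := p
  obtain ⟨k, l⟩ := q
  have hij : i ≤ j := by
    rcases hp with h | h
    · exact le_of_lt h
    · simp only [Prod.mk.injEq] at h; omega
  have hkl : k ≤ l := by
    rcases hq with h | h
    · exact le_of_lt h
    · simp only [Prod.mk.injEq] at h; omega
  have key : ∀ {i j k l : ℕ}, i ≤ j → k ≤ l → j ≤ N → l ≤ N → lbP N i j = lbP N k l → i < k →
      i = j ∧ k = l := by
    intro i j k l hij hkl hj hl he hik
    obtain ⟨eX, eY⟩ := lbP_eq he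
    rcases lb_chord_lt (N := N) (t := i) (s := j) (t' := k) (s' := l) (by positivity)
      (by exact_mod_cast hij) (by exact_mod_cast hkl) (by exact_mod_cast hl)
      (by exact_mod_cast hik) eX eY (by exact_mod_cast hj) with ⟨e1, e2⟩ | ⟨c1, c2, c3, b, c4, c5⟩
    · exact ⟨by exact_mod_cast e1, by exact_mod_cast e2⟩
    · exfalso
      have c1 : i < j := by exact_mod_cast c1
      have c2 : k < l := by exact_mod_cast c2
      have c3 : j < l := by exact_mod_cast c3
      have c4 : b ≤ i := by exact_mod_cast c4
      have c5 : l ≤ b + 1 := by exact_mod_cast c5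
      omega
  have zero : i = j → k = l → (i, j) = (k, l) := by
    intro e1 e2
    rcases hp with h1 | h1
    · simp only at h1; omega
    · rcases hq with h2 | h2
      · simp only at h2; omega
      · rw [h1, h2]
  simp only [lbPos] at h hN hN'
  rcases lt_trichotomy i k with hl | hl | hl
  · obtain ⟨e1, e2⟩ := key hij hkl hN hN' h hl
    exact zero e1 e2
  · subst hl
    have : (j : ℝ) = l := lbX_inj (N := N) (by positivity) (by exact_mod_cast hN) (by positivity)
      (by exact_mod_cast hN') (by linarith [(lbP_eq h).1])
    have : j = l := by exact_mod_cast this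
    rw [this]
  · obtain ⟨e1, e2⟩ := key hkl hij hN' hN h.symm hl
    exact zero e2 e1


/-- enumeration of the vertices -/
def lbSt : ℕ → ℕ × ℕ
  | 0 => (0, 0)
  | k + 1 => if (lbSt k).1 = 0 then ((lbSt k).2, (lbSt k).2 + 1) else ((lbSt k).1 - 1, (lbSt k).2)

lemma lbSt_succ (k : ℕ) : lbSt (k + 1) =
    if (lbSt k).1 = 0 then ((lbSt k).2, (lbSt k).2 + 1) else ((lbSt k).1 - 1, (lbSt k).2) := rfl

lemma lbSt_good (k : ℕ) : lbGood (lbSt k) := by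
  induction k with
  | zero => right; rfl
  | succ k ih =>
    left
    rw [lbSt_succ]
    split_ifs with h
    · simp
    · rcases ih with h1 | h1
      · simp only; omega
      · rw [h1] at h; exact absurd rfl h

lemma lbSt_lt (k : ℕ) (hk : k ≠ 0) : (lbSt k).1 < (lbSt k).2 := by
  obtain ⟨k, rfl⟩ := Nat.exists_eq_succ_of_ne_zero hk
  rw [Nat.succ_eq_add_one, lbSt_succ]
  split_ifs with h
  · simp
  · rcases lbSt_good k with h1 | h1
    · simp only; omega
    · rw [h1] at h; exact absurd rfl h

lemma lbSt_le (k : ℕ) : (lbSt k).2 ≤ k := by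
  induction k with
  | zero => exact le_rfl
  | succ k ih =>
    rw [lbSt_succ]
    split_ifs with h <;> simp only <;> omega

lemma lbSt_rank (k : ℕ) (hk : k ≠ 0) :
    2 * k + 2 * (lbSt k).1 = (lbSt k).2 * (lbSt k).2 + (lbSt k).2 := by
  obtain ⟨k, rfl⟩ := Nat.exists_eq_succ_of_ne_zero hk
  induction k with
  | zero => simp [lbSt]
  | succ k ih =>
    have ih := ih (by omega)
    have hlt := lbSt_lt (k + 1) (by omega)
    rw [Nat.succ_eq_add_one] at *
    rw [lbSt_succ (k + 1)]
    split_ifs with h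
    · simp only; rw [h] at ih; nlinarith
    · simp only; omega

lemma lbSt_inj {k l : ℕ} (h : lbSt k = lbSt l) : k = l := by
  by_cases hk : k = 0
  · by_contra hne
    have := lbSt_lt l (by omega)
    rw [← h, hk] at this
    simp [lbSt] at this
  · by_cases hl : l = 0
    · have := lbSt_lt k hk
      rw [h, hl] at this
      simp [lbSt] at this
    · have h1 := lbSt_rank k hk
      have h2 := lbSt_rank l hl
      rw [h] at h1
      omega

lemma lbSt_earlier (k : ℕ) : ∀ i j : ℕ, i < j →
    (j < (lbSt k).2 ∨ j = (lbSt k).2 ∧ (lbSt k).1 < i) → ∃ l < k, lbSt l = (i, j) := by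
  induction k with
  | zero => intro i j hij h; simp [lbSt] at h; omega
  | succ k ih =>
    intro i j hij h
    by_cases he : lbSt k = (i, j)
    · exact ⟨k, by omega, he⟩
    · obtain ⟨l, hl, h2⟩ := ih i j hij (by
        have he' : ¬ ((lbSt k).1 = i ∧ (lbSt k).2 = j) := fun hh => he (Prod.ext hh.1 hh.2)
        rw [lbSt_succ] at h
        split_ifs at h with h0 <;> simp only at h <;> omega)
      exact ⟨l, by omega, h2⟩

lemma lbSt_nrm_earlier {k : ℕ} {i j : ℕ} (hk : k ≠ 0) (hij : i ≤ j)
    (h : j < (lbSt k).2 ∨ j = (lbSt k).2 ∧ (lbSt k).1 < i) : ∃ l < k, lbSt l = lbNrm (i, j) := by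
  unfold lbNrm
  simp only
  split_ifs with h1
  · exact ⟨0, by omega, rfl⟩
  · exact lbSt_earlier k i j (by omega) h

lemma lbPar_one (k : ℕ) (hk : k ≠ 0) : ∃ l < k, lbSt l = lbNrm ((lbSt k).1, (lbSt k).2 - 1) := by
  have := lbSt_lt k hk
  exact lbSt_nrm_earlier hk (by omega) (by omega)

lemma lbPar_two (k : ℕ) (hk : k ≠ 0) : ∃ l < k, lbSt l = lbNrm ((lbSt k).1 + 1, (lbSt k).2) := by
  have := lbSt_lt k hk
  exact lbSt_nrm_earlier hk (by omega) (by omega)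

lemma lbPar_ne {k : ℕ} (h : (lbSt k).1 + 1 < (lbSt k).2) :
    lbNrm ((lbSt k).1, (lbSt k).2 - 1) ≠ lbNrm ((lbSt k).1 + 1, (lbSt k).2) := by
  unfold lbNrm
  simp only
  rw [if_neg (by omega), if_neg (by omega)]
  intro h2
  have := congrArg Prod.fst h2
  simp at this

/-- the lower bound graph -/
def lbG (n : ℕ) : SimpleGraph (Fin n) where
  Adj u v := lbPar (lbSt u) (lbSt v) ∨ lbPar (lbSt v) (lbSt u)
  symm := ⟨fun _ _ h => h.symm⟩
  loopless := ⟨fun u h => by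
    have := h.elim lbPar.len lbPar.len
    omega⟩

lemma lbG_adj {n : ℕ} {u v : Fin n} :
    (lbG n).Adj u v ↔ lbPar (lbSt u) (lbSt v) ∨ lbPar (lbSt v) (lbSt u) := Iff.rfl

lemma lbG_cliqueFree (n : ℕ) : (lbG n).CliqueFree 3 := by
  intro s hs
  obtain ⟨a, b, c, h1, h2, h3, -⟩ := SimpleGraph.is3Clique_iff.1 hs
  rw [lbG_adj] at h1 h2 h3
  rcases h1 with h1 | h1 <;> rcases h2 with h2 | h2 <;> rcases h3 with h3 | h3 <;>
    have h1 := h1.len <;> have h2 := h2.len <;> have h3 := h3.len <;> omega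

lemma lbG_noncross {n : ℕ} (u v a b : Fin n) (h : (lbG n).Adj u v) (h' : (lbG n).Adj a b)
    (hne : s(u, v) ≠ s(a, b)) :
    segment ℝ (lbPos n (lbSt u)) (lbPos n (lbSt v)) ∩
      segment ℝ (lbPos n (lbSt a)) (lbPos n (lbSt b)) ⊆
      ({lbPos n (lbSt u), lbPos n (lbSt v)} ∩ {lbPos n (lbSt a), lbPos n (lbSt b)} :
        Set (EuclideanSpace ℝ (Fin 2))) := by
  have hN : ∀ w : Fin n, (lbSt w).2 ≤ n := fun w => (lbSt_le w).trans w.2.le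
  have hst : ∀ {x y : Fin n}, lbSt x = lbSt y → x = y := fun h => Fin.ext (lbSt_inj h)
  have key : ∀ u v a b : Fin n, lbPar (lbSt u) (lbSt v) → lbPar (lbSt a) (lbSt b) →
      s(u, v) ≠ s(a, b) → segment ℝ (lbPos n (lbSt u)) (lbPos n (lbSt v)) ∩
      segment ℝ (lbPos n (lbSt a)) (lbPos n (lbSt b)) ⊆
      ({lbPos n (lbSt u), lbPos n (lbSt v)} ∩ {lbPos n (lbSt a), lbPos n (lbSt b)} :
        Set (EuclideanSpace ℝ (Fin 2))) := by
    rintro u v a b h1 h2 hne z ⟨hz, hz'⟩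
    exact lb_noncross h1 h2 (hN _) (hN _) (fun hh => hne (by
      rw [hst hh.1, hst hh.2])) hz hz'
  rcases h with h | h <;> rcases h' with h' | h'
  · exact key u v a b h h' hne
  · have := key u v b a h h' (by rwa [Sym2.eq_swap (a := b)])
    rwa [segment_symm ℝ (lbPos n (lbSt b)), Set.pair_comm (lbPos n (lbSt b))] at this
  · have := key v u a b h h' (by rwa [Sym2.eq_swap (a := v)])
    rwa [segment_symm ℝ (lbPos n (lbSt v)), Set.pair_comm (lbPos n (lbSt v))] at this
  · have := key v u b a h h' (by rwa [Sym2.eq_swap (a := b), Sym2.eq_swap (a := v)])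
    rwa [segment_symm ℝ (lbPos n (lbSt b)), Set.pair_comm (lbPos n (lbSt b)),
      segment_symm ℝ (lbPos n (lbSt v)), Set.pair_comm (lbPos n (lbSt v))] at this

lemma lbG_nbr {n : ℕ} (hn : 2 ≤ n) (w : Fin n) : ∃ x, (lbG n).Adj w x := by
  by_cases hw : (w : ℕ) = 0
  · refine ⟨⟨1, by omega⟩, Or.inr ?_⟩
    rw [hw]
    simp [lbSt, lbPar, lbNrm]
  · obtain ⟨l, hl, h⟩ := lbPar_one w hw
    exact ⟨⟨l, by omega⟩, Or.inl ⟨lbSt_lt w hw, Or.inl h⟩⟩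

/-- the lower bound graph is a matchstick graph -/
noncomputable def lbEmb (n : ℕ) : MatchstickEmbedding (lbG n) where
  pos v := lbPos n (lbSt v)
  inj u v h := Fin.ext (lbSt_inj (lb_inj (lbSt_good u) (lbSt_good v)
    ((lbSt_le u).trans u.2.le) ((lbSt_le v).trans v.2.le) h))
  unit u v h := by
    rcases h with h | h
    · exact lb_par_unit h ((lbSt_le u).trans u.2.le)
    · rw [dist_comm]; exact lb_par_unit h ((lbSt_le v).trans v.2.le)
  noVertexInterior w u v h hw := by
    have hinj : ∀ x y : Fin n, lbPos n (lbSt x) = lbPos n (lbSt y) → x = y := fun u v h =>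
      Fin.ext (lbSt_inj (lb_inj (lbSt_good u) (lbSt_good v)
        ((lbSt_le u).trans u.2.le) ((lbSt_le v).trans v.2.le) h))
    have huv : u ≠ v := h.ne
    have h1 : w ≠ u := by
      rintro rfl
      rw [left_mem_openSegment_iff] at hw
      exact huv (hinj _ _ hw)
    have h2 : w ≠ v := by
      rintro rfl
      rw [right_mem_openSegment_iff] at hw
      exact huv (hinj _ _ hw)
    have hn : 2 ≤ n := by
      by_contra hcon
      apply huv
      ext
      omega
    obtain ⟨x, hx⟩ := lbG_nbr hn w
    have hne : s(u, v) ≠ s(w, x) := by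
      intro he
      rcases Sym2.eq_iff.1 he with ⟨e, -⟩ | ⟨-, e⟩
      · exact h1 e.symm
      · exact h2 e.symm
    have := (lbG_noncross u v w x h hx hne
      ⟨openSegment_subset_segment _ _ _ hw, left_mem_segment _ _ _⟩).1
    rcases this with e | e
    · exact h1 (hinj _ _ e)
    · exact h2 (hinj _ _ e)
  noncross := lbG_noncross

/-- number of parents -/
def lbD (k : ℕ) : ℕ := if k = 0 then 0 else if (lbSt k).1 + 1 < (lbSt k).2 then 2 else 1

lemma lbD_sum (N : ℕ) : ∑ k ∈ Finset.range (N + 1), lbD k + (lbSt N).2 = 2 * N := by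
  induction N with
  | zero => simp [lbD, lbSt]
  | succ N ih =>
    rw [Finset.sum_range_succ]
    have : lbD (N + 1) + (lbSt (N + 1)).2 = (lbSt N).2 + 2 := by
      unfold lbD
      rw [if_neg (by omega), lbSt_succ]
      by_cases h : (lbSt N).1 = 0
      · simp only [h, if_true]
        rw [if_neg (by omega)]; omega
      · simp only [h, if_false]
        rcases lbSt_good N with h1 | h1
        · rw [if_pos (by omega)]; omega
        · rw [h1] at h; exact absurd rfl h
    omega

lemma lbG_edges (n : ℕ) : ∑ k ∈ Finset.range n, lbD k ≤ (lbG n).edgeSet.ncard := by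
  classical
  let T : Fin n → Finset (Fin n) := fun k =>
    Finset.univ.filter fun l => l < k ∧ lbPar (lbSt k) (lbSt l)
  have hT : ∀ k : Fin n, lbD k ≤ (T k).card := by
    intro k
    unfold lbD
    split_ifs with h0 h1
    · exact Nat.zero_le _
    · obtain ⟨l, hl, e⟩ := lbPar_one k h0
      obtain ⟨l', hl', e'⟩ := lbPar_two k h0
      have hne : (⟨l, by omega⟩ : Fin n) ≠ ⟨l', by omega⟩ := by
        intro hh
        apply lbPar_ne h1
        rw [← e, ← e', Fin.mk.inj hh]
      rw [← Finset.card_pair hne]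
      apply Finset.card_le_card
      intro x hx
      rw [Finset.mem_insert, Finset.mem_singleton] at hx
      rw [Finset.mem_filter]
      rcases hx with rfl | rfl
      · exact ⟨Finset.mem_univ _, hl, lbSt_lt k h0, Or.inl e⟩
      · exact ⟨Finset.mem_univ _, hl', lbSt_lt k h0, Or.inr e'⟩
    · obtain ⟨l, hl, e⟩ := lbPar_one k h0
      rw [Nat.one_le_iff_ne_zero, Finset.card_ne_zero]
      exact ⟨⟨l, by omega⟩, by
        rw [Finset.mem_filter]; exact ⟨Finset.mem_univ _, hl, lbSt_lt k h0, Or.inl e⟩⟩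
  rw [Finset.sum_range]
  calc ∑ k : Fin n, lbD k ≤ ∑ k : Fin n, (T k).card := Finset.sum_le_sum fun k _ => hT k
    _ = (Finset.univ.sigma T).card := (Finset.card_sigma _ _).symm
    _ = ((fun x : Σ _ : Fin n, Fin n => s(x.1, x.2)) '' ↑(Finset.univ.sigma T)).ncard := by
        rw [Set.ncard_image_of_injOn, Set.ncard_coe_finset]
        rintro ⟨a, b⟩ h ⟨c, d⟩ h' he
        simp only [Finset.coe_sigma, Set.mem_sigma_iff, Finset.mem_coe, T, Finset.mem_filter] at h h'
        rcases Sym2.eq_iff.1 he with ⟨e1, e2⟩ | ⟨e1, e2⟩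
        · simp only at e1 e2
          subst e1 e2; rfl
        · simp only at e1 e2
          subst e1 e2
          exact absurd h.2.2.1 (lt_asymm h'.2.2.1)
    _ ≤ (lbG n).edgeSet.ncard := by
        apply Set.ncard_le_ncard _ (Set.toFinite _)
        rintro _ ⟨⟨a, b⟩, h, rfl⟩
        simp only [Finset.coe_sigma, Set.mem_sigma_iff, Finset.mem_coe, T, Finset.mem_filter] at h
        exact Or.inl h.2.2.2

/-- combinatorial form of the lower bound -/
lemma lower_nat (N : ℕ) : ∃ m : ℕ, 2 * N ≤ maxTriangleFreeMatchstickEdges (N + 1) + m ∧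
    m * m ≤ 2 * N + m ∧ (N = 0 → m = 0) ∧ (N ≠ 0 → 1 ≤ m ∧ m * m + 2 ≤ 2 * N + m) := by
  refine ⟨(lbSt N).2, ?_, ?_, ?_, ?_⟩
  · have h1 := lbD_sum N
    have h2 := lbG_edges (N + 1)
    have h3 : (lbG (N + 1)).edgeSet.ncard ≤ maxTriangleFreeMatchstickEdges (N + 1) :=
      le_csSup (edges_bddAbove (N + 1)) ⟨lbG (N + 1), lbG_cliqueFree _, ⟨lbEmb _⟩, rfl⟩
    omega
  · by_cases h : N = 0
    · subst h; simp [lbSt]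
    · have h1 := lbSt_rank N h
      have h2 := lbSt_lt N h
      omega
  · rintro rfl; rfl
  · intro h
    have h1 := lbSt_rank N h
    have h2 := lbSt_lt N h
    exact ⟨by omega, by omega⟩

lemma lower_floor (n : ℕ) (hn : 1 ≤ n) :
    ⌊2 * (n : ℝ) - Real.sqrt (2 * n - 7 / 4) - 3 / 2⌋ ≤ (maxTriangleFreeMatchstickEdges n : ℤ) := by
  obtain ⟨N, rfl⟩ : ∃ N, n = N + 1 := ⟨n - 1, by omega⟩
  obtain ⟨m, h1, h2, h3, h4⟩ := lower_nat N
  have h1' : 2 * (N : ℤ) - m ≤ maxTriangleFreeMatchstickEdges (N + 1) := by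
    have : 2 * (N : ℤ) ≤ maxTriangleFreeMatchstickEdges (N + 1) + m := by exact_mod_cast h1
    linarith
  refine le_trans ?_ h1'
  rw [← Int.lt_add_one_iff, Int.floor_lt]
  push_cast
  have key : (m : ℝ) - 1 / 2 < Real.sqrt (2 * ((N : ℝ) + 1) - 7 / 4) := by
    by_cases h : N = 0
    · rw [h3 h]
      exact lt_of_lt_of_le (by norm_num) (Real.sqrt_nonneg _)
    · obtain ⟨h5, h6⟩ := h4 h
      have h6' : (m : ℝ) * m + 2 ≤ 2 * N + m := by exact_mod_cast h6
      apply Real.lt_sqrt_of_sq_lt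
      nlinarith
  linarith

lemma lower_const (n : ℕ) (hn : 1 ≤ n) :
    2 * n - Real.sqrt 2 * Real.sqrt n - 3 ≤ (maxTriangleFreeMatchstickEdges n : ℝ) := by
  obtain ⟨N, rfl⟩ : ∃ N, n = N + 1 := ⟨n - 1, by omega⟩
  obtain ⟨m, h1, h2, -, -⟩ := lower_nat N
  have h1' : 2 * (N : ℝ) ≤ maxTriangleFreeMatchstickEdges (N + 1) + m := by exact_mod_cast h1
  have h2' : (m : ℝ) * m ≤ 2 * N + m := by exact_mod_cast h2
  have hm : (0 : ℝ) ≤ m := by positivity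
  have key : (m : ℝ) - 1 ≤ Real.sqrt 2 * Real.sqrt ((N + 1 : ℕ) : ℝ) := by
    rw [← Real.sqrt_mul (by norm_num)]
    apply Real.le_sqrt_of_sq_le
    push_cast
    nlinarith
  push_cast at key ⊢
  linarith

theorem triangleFree_matchstick_maxEdges_bounds :
    (∀ n : ℕ, 1 ≤ n →
      ⌊2 * (n : ℝ) - Real.sqrt (2 * n - 7 / 4) - 3 / 2⌋ ≤
        (maxTriangleFreeMatchstickEdges n : ℤ)) ∧
    ∃ C : ℝ, ∀ n : ℕ, 1 ≤ n →
      2 * n - Real.sqrt 2 * Real.sqrt n - C ≤ (maxTriangleFreeMatchstickEdges n : ℝ) ∧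
      (maxTriangleFreeMatchstickEdges n : ℝ) ≤ 2 * n - Real.sqrt 2 / 5 * Real.sqrt n :=
  ⟨lower_floor, 3, fun n hn => ⟨lower_const n hn, upper_bound n hn⟩⟩
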